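/- Let B be a noetherian scheme, let S be a finite type B-scheme, let X and Y be finite type S-schemes, let s : B → S be a section of the structure morphism S → B, and let h : X_s ≅ Y_s be an isomorphism of B-schemes between the fibers X_s := X ×_{S,s} B and Y_s := Y ×_{S,s} B. Then there exist a scheme B₀ of finite type over Spec ℤ, a morphism B → B₀, a finite type B₀-scheme S₀, finite type S₀-schemes X₀ and Y₀, a section s₀ : B₀ → S₀ of S₀ → B₀, and an isomorphism h₀ : (X₀)_{s₀} ≅ (Y₀)_{s₀} of B₀-schemes, such that the base change of the data (X₀ → S₀ ← Y₀, s₀, h₀) along B → B₀ is isomorphic to the original data (X → S ← Y, s, h). -/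

import Mathlib

open AlgebraicGeometry CategoryTheory Limits
set_option linter.all false
section Part1
open AlgebraicGeometry CategoryTheory Limits

/-- Ring-theoretic core of the gluing step. -/
lemma algK {k R C G : Type*} [CommRing k] [CommRing R] [CommRing C] [CommRing G]
    [Algebra k R] [Algebra k C] [Algebra k G] (ρ : R →ₐ[k] G) (γ : C →ₐ[k] G)
    {ι : Type*} [Finite ι] (f : ι → R) (F : ι → C) (hfF : ∀ a, ρ (f a) = γ (F a))
    (h1 : ∀ a x, ρ x = 0 → ∃ m : ℕ, f a ^ m * x = 0)
    (h2 : ∀ a g, ∃ (m : ℕ) (r : R), ρ r = ρ (f a) ^ m * g)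
    (hft : ∀ a, Algebra.FiniteType k (Localization.Away (F a))) :
    ∃ A : Subalgebra k (R × C), Algebra.FiniteType k A ∧ (∀ e ∈ A, ρ e.1 = γ e.2) ∧
      (∀ a, (f a, F a) ∈ A) ∧
      (∀ a, ∀ e ∈ A, e.2 = 0 → ∃ m : ℕ, (f a, F a) ^ m * e = 0) ∧
      (∀ a c, ∃ m : ℕ, ∃ e ∈ A, e.2 = F a ^ m * c) := by
  classical
  cases nonempty_fintype ι
  choose T hT using fun a => (hft a).out
  have key : ∀ a (x : Localization.Away (F a)), ∃ (e : R × C), ρ e.1 = γ e.2 ∧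
      ∃ m : ℕ, algebraMap C _ e.2 = algebraMap C (Localization.Away (F a)) (F a) ^ m * x := by
    intro a x
    obtain ⟨n, c, hc⟩ := IsLocalization.Away.surj (F a) x
    obtain ⟨m, r, hr⟩ := h2 a (γ c)
    refine ⟨(r, F a ^ m * c), ?_, m + n, ?_⟩
    · simp [hr, hfF]
    · rw [pow_add, mul_assoc, mul_comm (_ ^ n) x, hc, map_mul, map_pow]
  choose E hE1 n hn using key
  let s : Set (R × C) := Set.range (fun a => (f a, F a)) ∪ ⋃ a, Set.image (E a) (T a)
  have hs : s.Finite := (Set.finite_range _).union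
    (Set.finite_iUnion fun a => (T a).finite_toSet.image _)
  refine ⟨Algebra.adjoin k s, ?_, ?_, ?_, ?_, ?_⟩
  · rw [← Subalgebra.fg_iff_finiteType]
    exact Subalgebra.fg_def.mpr ⟨s, hs, rfl⟩
  · intro e he
    have : Algebra.adjoin k s ≤ AlgHom.equalizer (ρ.comp (AlgHom.fst k R C))
        (γ.comp (AlgHom.snd k R C)) := by
      rw [Algebra.adjoin_le_iff]
      rintro x (⟨a, rfl⟩ | hx)
      · exact hfF a
      · simp only [Set.mem_iUnion, Set.mem_image] at hx
        obtain ⟨a, t, -, rfl⟩ := hx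
        exact hE1 a t
    exact this he
  · intro a
    exact Algebra.subset_adjoin (Or.inl ⟨a, rfl⟩)
  · intro a e he hc
    have h : ρ e.1 = γ e.2 := by
      have : Algebra.adjoin k s ≤ AlgHom.equalizer (ρ.comp (AlgHom.fst k R C))
        (γ.comp (AlgHom.snd k R C)) := by
        rw [Algebra.adjoin_le_iff]
        rintro x (⟨a, rfl⟩ | hx)
        · exact hfF a
        · simp only [Set.mem_iUnion, Set.mem_image] at hx
          obtain ⟨a, t, -, rfl⟩ := hx
          exact hE1 a t
      exact this he
    rw [hc, map_zero] at h
    obtain ⟨m, hm⟩ := h1 a _ h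
    refine ⟨m, ?_⟩
    ext <;> simp [hm, hc]
  · intro a c
    let L := Localization.Away (F a)
    have hF : (f a, F a) ∈ Algebra.adjoin k s := Algebra.subset_adjoin (Or.inl ⟨a, rfl⟩)
    let S : Subalgebra k L :=
      { carrier := {x | ∃ m : ℕ, ∃ e ∈ Algebra.adjoin k s,
          algebraMap C L e.2 = algebraMap C L (F a) ^ m * x}
        mul_mem' := by
          rintro x y ⟨m, e, he, h⟩ ⟨m', e', he', h'⟩
          refine ⟨m + m', e * e', mul_mem he he', ?_⟩
          rw [Prod.snd_mul, map_mul, h, h']; ring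
        add_mem' := by
          rintro x y ⟨m, e, he, h⟩ ⟨m', e', he', h'⟩
          refine ⟨m + m', (f a, F a) ^ m' * e + (f a, F a) ^ m * e',
            add_mem (mul_mem (pow_mem hF _) he) (mul_mem (pow_mem hF _) he'), ?_⟩
          simp only [Prod.snd_add, Prod.snd_mul, Prod.pow_snd, map_add, map_mul, map_pow, h, h']
          ring
        algebraMap_mem' := by
          intro r
          refine ⟨0, algebraMap k _ r, Subalgebra.algebraMap_mem _ _, ?_⟩
          simp only [Prod.algebraMap_apply, pow_zero, one_mul]
          rw [← IsScalarTower.algebraMap_apply] }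
    have hS : S = ⊤ := by
      rw [eq_top_iff, ← hT a, Algebra.adjoin_le_iff]
      intro t ht
      refine ⟨n a t, E a t, Algebra.subset_adjoin (Or.inr ?_), hn a t⟩
      exact Set.mem_iUnion.mpr ⟨a, t, ht, rfl⟩
    have : algebraMap C L c ∈ S := hS ▸ Algebra.mem_top
    obtain ⟨m, e, he, h⟩ := this
    rw [← map_pow, ← map_mul] at h
    obtain ⟨l, hl⟩ := IsLocalization.Away.exists_of_eq (F a) h
    refine ⟨l + m, (f a, F a) ^ l * e, mul_mem (pow_mem hF _) he, ?_⟩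
    simp only [Prod.snd_mul, Prod.pow_snd, hl]
    ring
end Part1

section Part2
open AlgebraicGeometry CategoryTheory Limits

lemma K1_loc {E : Scheme.{0}} [CompactSpace E] [QuasiSeparatedSpace E] {A : CommRingCat.{0}}
    (φ : A ⟶ Γ(E, ⊤)) (p : A)
    (h1 : ∀ x : A, φ x = 0 → ∃ m : ℕ, p ^ m * x = 0)
    (h2 : ∀ c : Γ(E, ⊤), ∃ (m : ℕ) (x : A), φ x = φ p ^ m * c) :
    letI := (φ ≫ E.presheaf.map (homOfLE (E.basicOpen_le (φ p))).op).hom.toAlgebra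
    IsLocalization.Away p Γ(E, E.basicOpen (φ p)) := by
  have key : ∀ (r : Γ(E, ⊤)) (hr : φ p = r),
    letI := (φ ≫ E.presheaf.map (homOfLE (E.basicOpen_le r)).op).hom.toAlgebra
    IsLocalization.Away p Γ(E, E.basicOpen r) := by
    intro r hr
    have := isLocalization_basicOpen_of_qcqs (X := E) isCompact_univ isQuasiSeparated_univ r
    letI alg := (φ ≫ E.presheaf.map (homOfLE (E.basicOpen_le r)).op).hom.toAlgebra
    have hm : ∀ x : A, algebraMap A Γ(E, E.basicOpen r) x =
        algebraMap Γ(E, ⊤) Γ(E, E.basicOpen r) (φ x) := fun x => rfl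
    refine ⟨?_, ?_, ?_⟩
    · rintro ⟨_, n, rfl⟩
      simp only [map_pow, hm, hr]
      exact (IsLocalization.Away.algebraMap_isUnit r).pow n
    · intro z
      obtain ⟨n, c, hc⟩ := IsLocalization.Away.surj (x := r) z
      obtain ⟨m, x, hx⟩ := h2 c
      refine ⟨(x, ⟨p ^ (n + m), _, rfl⟩), ?_⟩
      simp only [map_pow, hm, hx, map_mul, hr]
      rw [← hc]
      ring
    · intro x y hxy
      rw [hm, hm] at hxy
      obtain ⟨⟨_, n, rfl⟩, hc⟩ := IsLocalization.exists_of_eq (M := Submonoid.powers r) hxy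
      obtain ⟨m, hm'⟩ := h1 (p ^ n * (x - y)) (by
        simp only [map_mul, map_pow, map_sub, mul_sub, hr]
        exact sub_eq_zero.mpr hc)
      refine ⟨⟨p ^ (m + n), _, rfl⟩, ?_⟩
      rw [← sub_eq_zero, ← hm']
      simp only; ring
  exact key _ rfl

lemma K1_eq {E : Scheme.{0}} {A : CommRingCat.{0}} (φ : A ⟶ Γ(E, ⊤)) {ι : Type} (p : ι → A)
    (haff : ∀ a, IsAffineOpen (E.basicOpen (φ (p a)))) (a : ι) :
    (E.basicOpen (φ (p a))).ι ≫ E.toSpecΓ ≫ Spec.map φ =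
    (haff a).isoSpec.hom ≫
      Spec.map (φ ≫ E.presheaf.map (homOfLE (E.basicOpen_le (φ (p a)))).op) := by
  rw [Spec.map_comp, ← Category.assoc, ← Category.assoc]
  congr 1
  exact (Scheme.Opens.toSpecΓ_SpecMap_presheaf_map_top _).symm

lemma K1_preimage {E : Scheme.{0}} {A : CommRingCat.{0}} (φ : A ⟶ Γ(E, ⊤)) (x : A) :
    (E.toSpecΓ ≫ Spec.map φ) ⁻¹ᵁ (PrimeSpectrum.basicOpen x) =
    E.basicOpen (φ x) := 
  (Scheme.Hom.comp_preimage _ _ _).trans (Scheme.toSpecΓ_preimage_basicOpen E (φ x))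

lemma K1_isOpenImmersion {E : Scheme.{0}} [CompactSpace E] [QuasiSeparatedSpace E]
    {A : CommRingCat.{0}}
    (φ : A ⟶ Γ(E, ⊤)) {ι : Type} (p : ι → A)
    (haff : ∀ a, IsAffineOpen (E.basicOpen (φ (p a))))
    (hcov : ⨆ a, E.basicOpen (φ (p a)) = ⊤)
    (h1 : ∀ a, ∀ x : A, φ x = 0 → ∃ m : ℕ, p a ^ m * x = 0)
    (h2 : ∀ a, ∀ c : Γ(E, ⊤), ∃ (m : ℕ) (x : A), φ x = φ (p a) ^ m * c) :
    IsOpenImmersion (E.toSpecΓ ≫ Spec.map φ) := by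
  refine IsZariskiLocalAtTarget.of_forall_source_exists_preimage _ fun x ↦ ?_
  have hx : x ∈ ⨆ a, E.basicOpen (φ (p a)) := by rw [hcov]; trivial
  obtain ⟨a, hxr⟩ := TopologicalSpace.Opens.mem_iSup.mp hx
  refine ⟨PrimeSpectrum.basicOpen (p a), (K1_preimage φ (p a)).ge hxr, ?_⟩
  suffices IsOpenImmersion ((E.basicOpen (φ (p a))).ι ≫ E.toSpecΓ ≫ Spec.map φ) by
    convert! this <;> rw [K1_preimage]
  rw [K1_eq φ p haff]
  letI := (φ ≫ E.presheaf.map (homOfLE (E.basicOpen_le (φ (p a)))).op).hom.toAlgebra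
  have := K1_loc φ (p a) (h1 a) (h2 a)
  exact MorphismProperty.comp_mem _ (haff a).isoSpec.hom _ inferInstance (.of_isLocalization (p a))

lemma K1_range {E : Scheme.{0}} [CompactSpace E] [QuasiSeparatedSpace E]
    {A : CommRingCat.{0}}
    (φ : A ⟶ Γ(E, ⊤)) {ι : Type} (p : ι → A)
    (haff : ∀ a, IsAffineOpen (E.basicOpen (φ (p a))))
    (hcov : ⨆ a, E.basicOpen (φ (p a)) = ⊤)
    (h1 : ∀ a, ∀ x : A, φ x = 0 → ∃ m : ℕ, p a ^ m * x = 0)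
    (h2 : ∀ a, ∀ c : Γ(E, ⊤), ∃ (m : ℕ) (x : A), φ x = φ (p a) ^ m * c) (y : Spec A) :
    y ∈ Set.range (E.toSpecΓ ≫ Spec.map φ) ↔
    ∃ a, y ∈ PrimeSpectrum.basicOpen (p a) := by
  constructor
  · rintro ⟨x, rfl⟩
    have hx : x ∈ ⨆ a, E.basicOpen (φ (p a)) := by rw [hcov]; trivial
    obtain ⟨a, hxr⟩ := TopologicalSpace.Opens.mem_iSup.mp hx
    exact ⟨a, (K1_preimage φ (p a)).ge hxr⟩
  · rintro ⟨a, hy⟩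
    letI := (φ ≫ E.presheaf.map (homOfLE (E.basicOpen_le (φ (p a)))).op).hom.toAlgebra
    have := K1_loc φ (p a) (h1 a) (h2 a)
    have hr := PrimeSpectrum.localization_away_comap_range Γ(E, E.basicOpen (φ (p a))) (p a)
    have hy' : y ∈ (PrimeSpectrum.basicOpen (p a) : Set (PrimeSpectrum A)) := hy
    rw [← hr] at hy'
    obtain ⟨z, hz⟩ := hy'
    refine ⟨((haff a).isoSpec.inv ≫ (E.basicOpen (φ (p a))).ι) z, ?_⟩
    rw [← hz]
    have : ((haff a).isoSpec.inv ≫ (E.basicOpen (φ (p a))).ι) ≫ E.toSpecΓ ≫ Spec.map φ =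
      Spec.map (φ ≫ E.presheaf.map (homOfLE (E.basicOpen_le (φ (p a)))).op) := by
      rw [Category.assoc, K1_eq φ p haff, Iso.inv_hom_id_assoc]
    exact congr($(this) z)
end Part2

section Part3
open AlgebraicGeometry CategoryTheory Limits

section po
variable {U X Y : Scheme.{0}} (f : U ⟶ X) (g : U ⟶ Y) [IsOpenImmersion f] [IsOpenImmersion g]

instance po_inl : IsOpenImmersion (pushout.inl f g) :=
  inferInstanceAs (IsOpenImmersion (colimit.ι (span f g) _))
instance po_inr : IsOpenImmersion (pushout.inr f g) :=
  inferInstanceAs (IsOpenImmersion (colimit.ι (span f g) _))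

lemma po_surj (x : ↥(pushout f g)) :
    (∃ a, pushout.inl f g a = x) ∨ (∃ b, pushout.inr f g b = x) := by
  obtain ⟨i, a, h⟩ := Scheme.IsLocallyDirected.ι_jointly_surjective (span f g) x
  obtain _ | (_ | _) := i
  · left
    have := (colimit.w (span f g) WalkingSpan.Hom.fst)
    refine ⟨(span f g).map WalkingSpan.Hom.fst a, ?_⟩
    exact congr($(this) a).trans h
  · exact .inl ⟨a, h⟩
  · exact .inr ⟨a, h⟩

lemma po_eq (a : X) (b : Y) (h : pushout.inl f g a = pushout.inr f g b) :
    ∃ u, f u = a ∧ g u = b := by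
  obtain ⟨k, fi, fj, x, h1, h2⟩ :=
    (Scheme.IsLocallyDirected.ι_eq_ι_iff (span f g) (i := .left) (j := .right)
      (xi := a) (xj := b)).mp h
  obtain _ | (_ | _) := k
  · refine ⟨x, ?_, ?_⟩
    · rw [← h1, Subsingleton.elim fi WalkingSpan.Hom.fst]; rfl
    · rw [← h2, Subsingleton.elim fj WalkingSpan.Hom.snd]; rfl
  · exact nomatch fj
  · exact nomatch fi
end po

section lim
variable {J : Type} [Category.{0} J] [IsCofiltered J] {D : J ⥤ Scheme.{0}} (c : Cone D)
  {κ : Type} (Da : κ → J ⥤ Scheme.{0}) (τ : ∀ a, Da a ⟶ D) [∀ a j, IsOpenImmersion ((τ a).app j)]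
  (ca : ∀ a, Cone (Da a)) (m : ∀ a, (ca a).pt ⟶ c.pt)
  [∀ a, IsOpenImmersion (m a)]

/-- the cover induced on a cone point -/
def limU (s : Cone D) (j : J) (a : κ) : s.pt.Opens :=
  (s.π.app j) ⁻¹ᵁ ((τ a).app j).opensRange

lemma limU_cov (hcov : ∀ j (x : D.obj j), ∃ a, x ∈ Set.range ((τ a).app j)) (s : Cone D) (j : J) : ⨆ a, limU Da τ s j a = ⊤ := by
  refine top_le_iff.mp fun x _ ↦ ?_
  obtain ⟨a, ha⟩ := hcov j (s.π.app j x)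
  exact TopologicalSpace.Opens.mem_iSup.mpr ⟨a, ha⟩

lemma limU_mem (hD : ∀ a {i j : J} (f : i ⟶ j) (x : D.obj i), D.map f x ∈ Set.range ((τ a).app j) →
    x ∈ Set.range ((τ a).app i)) (s : Cone D) (j0 j : J) (a : κ) (x : s.pt) (hx : x ∈ limU Da τ s j0 a) :
    s.π.app j x ∈ Set.range ((τ a).app j) := by
  let k := IsCofiltered.min j0 j
  have h1 : s.π.app k x ∈ Set.range ((τ a).app k) := by
    refine hD a (IsCofiltered.minToLeft j0 j) _ ?_
    rw [← Scheme.Hom.comp_apply, s.w]; exact hx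
  obtain ⟨y, hy⟩ := h1
  refine ⟨(Da a).map (IsCofiltered.minToRight j0 j) y, ?_⟩
  rw [← Scheme.Hom.comp_apply, (τ a).naturality, Scheme.Hom.comp_apply, hy,
    ← Scheme.Hom.comp_apply, s.w]

lemma lim_uniq (hca : ∀ a, IsLimit (ca a))
    (hm : ∀ a j, m a ≫ c.π.app j = (ca a).π.app j ≫ (τ a).app j)
    (hr : ∀ a j (x : c.pt), c.π.app j x ∈ Set.range ((τ a).app j) → x ∈ Set.range (m a))
    (hcov : ∀ j (x : D.obj j), ∃ a, x ∈ Set.range ((τ a).app j)) {T : Scheme.{0}} (p q : T ⟶ c.pt) (h : ∀ j, p ≫ c.π.app j = q ≫ c.π.app j) :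
    p = q := by
  obtain ⟨j0⟩ : Nonempty J := IsCofiltered.nonempty
  let U : κ → T.Opens := fun a => (p ≫ c.π.app j0) ⁻¹ᵁ ((τ a).app j0).opensRange
  have hU : ⨆ a, U a = ⊤ := by
    refine top_le_iff.mp fun x _ ↦ ?_
    obtain ⟨a, ha⟩ := hcov j0 ((p ≫ c.π.app j0) x)
    exact TopologicalSpace.Opens.mem_iSup.mpr ⟨a, ha⟩
  refine (T.openCoverOfIsOpenCover U hU).hom_ext _ _ fun (a : κ) => ?_
  change (U a).ι ≫ p = (U a).ι ≫ q
  have hp : Set.range ((U a).ι ≫ p) ⊆ Set.range (m a) := by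
    rintro _ ⟨x, rfl⟩
    apply hr a j0
    rw [← Scheme.Hom.comp_apply, Category.assoc]
    exact x.2
  have hq : Set.range ((U a).ι ≫ q) ⊆ Set.range (m a) := by
    rintro _ ⟨x, rfl⟩
    apply hr a j0
    rw [← Scheme.Hom.comp_apply, Category.assoc, ← h]
    exact x.2
  rw [← IsOpenImmersion.lift_fac (m a) _ hp, ← IsOpenImmersion.lift_fac (m a) _ hq]
  congr 1
  refine (hca a).hom_ext fun j => ?_
  rw [← cancel_mono ((τ a).app j), Category.assoc, Category.assoc, ← hm,
    IsOpenImmersion.lift_fac_assoc, IsOpenImmersion.lift_fac_assoc, Category.assoc, h,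
    Category.assoc]

lemma lim_exists (hca : ∀ a, IsLimit (ca a))
    (hm : ∀ a j, m a ≫ c.π.app j = (ca a).π.app j ≫ (τ a).app j)
    (hr : ∀ a j (x : c.pt), c.π.app j x ∈ Set.range ((τ a).app j) → x ∈ Set.range (m a))
    (hD : ∀ a {i j : J} (f : i ⟶ j) (x : D.obj i), D.map f x ∈ Set.range ((τ a).app j) →
    x ∈ Set.range ((τ a).app i))
    (hcov : ∀ j (x : D.obj j), ∃ a, x ∈ Set.range ((τ a).app j)) (s : Cone D) : ∃ l : s.pt ⟶ c.pt, ∀ j, l ≫ c.π.app j = s.π.app j := by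
  obtain ⟨j0⟩ : Nonempty J := IsCofiltered.nonempty
  let U : κ → s.pt.Opens := limU Da τ s j0
  have hU : ⨆ a, U a = ⊤ := limU_cov Da τ hcov s j0
  have hran : ∀ a j, Set.range ((U a).ι ≫ s.π.app j) ⊆ Set.range ((τ a).app j) := by
    rintro a j _ ⟨x, rfl⟩
    exact limU_mem Da τ hD s j0 j a _ x.2
  let sa : ∀ a, Cone (Da a) := fun a =>
    { pt := U a
      π := { app := fun j => IsOpenImmersion.lift ((τ a).app j) _ (hran a j)
             naturality := fun i j f => by
              rw [← cancel_mono ((τ a).app j)]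
              simp only [Functor.const_obj_obj, Functor.const_obj_map, Category.assoc,
                Category.id_comp, (τ a).naturality, IsOpenImmersion.lift_fac,
                IsOpenImmersion.lift_fac_assoc, s.w] } }
  obtain ⟨la, hla⟩ : ∃ la : ∀ a, (U a).toScheme ⟶ c.pt,
      ∀ a j, la a ≫ c.π.app j = (U a).ι ≫ s.π.app j := by
    refine ⟨fun a => (hca a).lift (sa a) ≫ m a, ?_⟩
    intro a j
    simp only [Category.assoc, hm, IsLimit.fac_assoc]
    exact IsOpenImmersion.lift_fac _ _ _
  let 𝒰 := s.pt.openCoverOfIsOpenCover U hU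
  refine ⟨𝒰.glueMorphisms la fun (a b : κ) => ?_, fun j => ?_⟩
  · refine lim_uniq c Da τ ca m hca hm hr hcov _ _ fun j => ?_
    change (pullback.fst (U a).ι (U b).ι ≫ la a) ≫ _ =
      (pullback.snd (U a).ι (U b).ι ≫ la b) ≫ _
    rw [Category.assoc, Category.assoc, hla, hla, pullback.condition_assoc]
  · refine 𝒰.hom_ext _ _ fun (a : κ) => ?_
    exact (Scheme.Cover.ι_glueMorphisms_assoc 𝒰 la _ a _).trans (hla a j)

lemma lim_nonempty (hca : ∀ a, IsLimit (ca a))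
    (hm : ∀ a j, m a ≫ c.π.app j = (ca a).π.app j ≫ (τ a).app j)
    (hr : ∀ a j (x : c.pt), c.π.app j x ∈ Set.range ((τ a).app j) → x ∈ Set.range (m a))
    (hD : ∀ a {i j : J} (f : i ⟶ j) (x : D.obj i), D.map f x ∈ Set.range ((τ a).app j) →
    x ∈ Set.range ((τ a).app i))
    (hcov : ∀ j (x : D.obj j), ∃ a, x ∈ Set.range ((τ a).app j)) : Nonempty (IsLimit c) := by
  choose l hl using lim_exists c Da τ ca m hca hm hr hD hcov
  exact ⟨{ lift := l
           fac := hl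
           uniq := fun s q hq => lim_uniq c Da τ ca m hca hm hr hcov _ _
            fun j => (hq j).trans (hl s j).symm }⟩
end lim
end Part3

section Part4
open AlgebraicGeometry CategoryTheory Limits

/-- two-element open cover -/
def cov2 {U V N : Scheme.{0}} (u : U ⟶ N) (v : V ⟶ N) [IsOpenImmersion u] [IsOpenImmersion v]
    (hcov : ∀ x : N, x ∈ Set.range u ∨ x ∈ Set.range v) : N.OpenCover :=
  Scheme.Cover.mkOfCovers Bool (fun b => b.rec U V) (fun b => b.rec u v)
    (fun x => (hcov x).elim (fun ⟨y, hy⟩ => ⟨false, y, hy⟩) (fun ⟨y, hy⟩ => ⟨true, y, hy⟩))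
    (fun b => by cases b <;> dsimp only <;> infer_instance)

lemma cov2_ext {U V N : Scheme.{0}} (u : U ⟶ N) (v : V ⟶ N) [IsOpenImmersion u] [IsOpenImmersion v]
    (hcov : ∀ x : N, x ∈ Set.range u ∨ x ∈ Set.range v) {Z : Scheme.{0}} (a b : N ⟶ Z)
    (h1 : u ≫ a = u ≫ b) (h2 : v ≫ a = v ≫ b) : a = b := by
  refine (cov2 u v hcov).hom_ext _ _ fun (i : Bool) => ?_
  cases i
  · exact h1
  · exact h2

lemma glue2 {W U V N : Scheme.{0}} {wU : W ⟶ U} {wV : W ⟶ V} {u : U ⟶ N} {v : V ⟶ N}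
    [IsOpenImmersion u] [IsOpenImmersion v] (hW : IsPullback wU wV u v)
    (hcov : ∀ x : N, x ∈ Set.range u ∨ x ∈ Set.range v) {Z : Scheme.{0}} (a : U ⟶ Z) (b : V ⟶ Z)
    (h : wU ≫ a = wV ≫ b) : ∃ n : N ⟶ Z, u ≫ n = a ∧ v ≫ n = b := by
  have key1 : pullback.fst u v ≫ a = pullback.snd u v ≫ b := by
    rw [← hW.isoPullback_inv_fst, ← hW.isoPullback_inv_snd, Category.assoc, Category.assoc, h]
  have key2 : pullback.fst v u ≫ b = pullback.snd v u ≫ a := by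
    rw [← cancel_epi (pullbackSymmetry u v).hom]
    simp [key1]
  have key0 : ∀ {P : Scheme.{0}} (w : P ⟶ N) [Mono w], pullback.fst w w = pullback.snd w w := by
    intro P w _
    rw [← cancel_mono w]
    exact pullback.condition
  have key3 : pullback.fst u u ≫ a = pullback.snd u u ≫ a := by rw [key0 u]
  have key4 : pullback.fst v v ≫ b = pullback.snd v v ≫ b := by rw [key0 v]
  let F : ∀ i : (cov2 u v hcov).I₀, (cov2 u v hcov).X i ⟶ Z := fun i => Bool.rec a b i
  have hF : ∀ i j : (cov2 u v hcov).I₀, pullback.fst ((cov2 u v hcov).f i) ((cov2 u v hcov).f j) ≫ F i =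
      pullback.snd ((cov2 u v hcov).f i) ((cov2 u v hcov).f j) ≫ F j := by
    intro i j
    change Bool at i j
    cases i <;> cases j
    · exact key3
    · exact key1
    · exact key2
    · exact key4
  exact ⟨(cov2 u v hcov).glueMorphisms F hF, (cov2 u v hcov).ι_glueMorphisms F hF false,
    (cov2 u v hcov).ι_glueMorphisms F hF true⟩

lemma res_eq {X : Scheme.{0}} (f : Γ(X, ⊤)) : X.presheaf.map (homOfLE (X.basicOpen_le f)).op =
      (X.basicOpen f).ι.appTop ≫ (X.basicOpen f).topIso.hom := by
  rw [Scheme.Opens.ι_appTop]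
  exact (congrArg X.presheaf.map (Subsingleton.elim _ _)).trans (X.presheaf.map_comp _ _)

lemma zero_test {X : Scheme.{0}} [CompactSpace X] (f x : Γ(X, ⊤))
    (h : (X.basicOpen f).ι.appTop x = 0) : ∃ n : ℕ, f ^ n * x = 0 := by
  refine exists_pow_mul_eq_zero_of_res_basicOpen_eq_zero_of_isCompact X isCompact_univ x f ?_
  have h2 := res_eq f
  change X.presheaf.map (homOfLE (X.basicOpen_le f)).op x = 0
  rw [h2, CommRingCat.comp_apply, h, map_zero]

lemma frac_test {X : Scheme.{0}} [CompactSpace X] [QuasiSeparatedSpace X] (f : Γ(X, ⊤))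
    (z : Γ(X.basicOpen f, ⊤)) :
    ∃ (n : ℕ) (r : Γ(X, ⊤)), (X.basicOpen f).ι.appTop r = (X.basicOpen f).ι.appTop f ^ n * z := by
  have h2 := res_eq f
  obtain ⟨n, y, hy⟩ := exists_eq_pow_mul_of_isCompact_of_isQuasiSeparated X ⊤ isCompact_univ
    isQuasiSeparated_univ f ((X.basicOpen f).topIso.hom z)
  refine ⟨n, y, ?_⟩
  change X.presheaf.map (homOfLE (X.basicOpen_le f)).op y =
    X.presheaf.map (homOfLE (X.basicOpen_le f)).op f ^ n * _ at hy
  rw [h2, CommRingCat.comp_apply, CommRingCat.comp_apply, ← map_pow, ← map_mul] at hy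
  exact (ConcreteCategory.bijective_of_isIso (X.basicOpen f).topIso.hom).1 hy

lemma rho_h1 {V W : Scheme.{0}} [CompactSpace V] (wV : W ⟶ V) [IsOpenImmersion wV]
    (f : Γ(V, ⊤)) (hf : (V.basicOpen f : Set V) ⊆ Set.range wV) (x : Γ(V, ⊤))
    (hx : wV.appTop x = 0) : ∃ m : ℕ, f ^ m * x = 0 := by
  apply zero_test
  have : Set.range (V.basicOpen f).ι ⊆ Set.range wV := by simpa using hf
  rw [← IsOpenImmersion.lift_fac wV (V.basicOpen f).ι this, Scheme.Hom.comp_appTop,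
    CommRingCat.comp_apply, hx, map_zero]

lemma rho_h2 {V W : Scheme.{0}} [CompactSpace V] [QuasiSeparatedSpace V] [CompactSpace W]
    (wV : W ⟶ V) [IsOpenImmersion wV]
    (f : Γ(V, ⊤)) (hf : (V.basicOpen f : Set V) ⊆ Set.range wV) (g : Γ(W, ⊤)) :
    ∃ (m : ℕ) (r : Γ(V, ⊤)), wV.appTop r = wV.appTop f ^ m * g := by
  have h0 : Set.range (V.basicOpen f).ι ⊆ Set.range wV := by simpa using hf
  let l := IsOpenImmersion.lift wV (V.basicOpen f).ι h0
  have hl : l ≫ wV = (V.basicOpen f).ι := IsOpenImmersion.lift_fac wV (V.basicOpen f).ι h0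
  have h1 : Set.range ((W.basicOpen (wV.appTop f)).ι ≫ wV) ⊆ Set.range (V.basicOpen f).ι := by
    rintro _ ⟨x, rfl⟩
    have := (Scheme.preimage_basicOpen_top wV f).ge x.2
    rw [Scheme.Opens.range_ι]
    exact this
  let l' := IsOpenImmersion.lift (V.basicOpen f).ι _ h1
  have hl' : l' ≫ (V.basicOpen f).ι = (W.basicOpen (wV.appTop f)).ι ≫ wV :=
    IsOpenImmersion.lift_fac _ _ h1
  have hll : (W.basicOpen (wV.appTop f)).ι = l' ≫ l := by
    rw [← cancel_mono wV, Category.assoc, hl, hl']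
  obtain ⟨n, r, hr⟩ := frac_test f (l.appTop g)
  obtain ⟨m, hm⟩ := zero_test (wV.appTop f) (wV.appTop r - wV.appTop f ^ n * g) (by
    rw [hll, Scheme.Hom.comp_appTop, CommRingCat.comp_apply]
    have : l.appTop (wV.appTop r - wV.appTop f ^ n * g) = 0 := by
      rw [map_sub, map_mul, map_pow, ← CommRingCat.comp_apply, ← CommRingCat.comp_apply,
        ← Scheme.Hom.comp_appTop, hl, hr, sub_self]
    rw [this, map_zero])
  refine ⟨m + n, f ^ m * r, ?_⟩
  rw [map_mul, map_pow]
  rw [mul_sub, sub_eq_zero] at hm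
  rw [hm]; ring

lemma hft_aux {E : Scheme.{0}} [CompactSpace E] [QuasiSeparatedSpace E]
    [LocallyOfFiniteType (specZIsTerminal.from E)] (F : Γ(E, ⊤))
    (hF : IsAffineOpen (E.basicOpen F)) : Algebra.FiniteType ℤ (Localization.Away F) := by
  have := isLocalization_basicOpen_of_qcqs (X := E) isCompact_univ isQuasiSeparated_univ F
  let e := IsLocalization.algEquiv (Submonoid.powers F) (Localization.Away F)
    Γ(E, E.basicOpen F)
  have h := Scheme.Hom.finiteType_appLE (specZIsTerminal.from E) (isAffineOpen_top _) hF le_top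
  have h2 := h.comp (RingHom.FiniteType.of_surjective
    (Scheme.ΓSpecIso (CommRingCat.of ℤ)).inv.hom
    (ConcreteCategory.bijective_of_isIso _).2)
  have h3 := (RingHom.FiniteType.of_surjective
    (e.symm.toRingEquiv.toRingHom) e.symm.surjective).comp h2
  rw [← RingHom.finiteType_algebraMap]
  convert! h3
  exact Subsingleton.elim _ _
end Part4

section Part5
open AlgebraicGeometry CategoryTheory Limits

/-- Data for the gluing step of the approximation. -/
structure SD where
  I : Type
  [cat : Category.{0} I]
  [cof : IsCofiltered I]
  D : I ⥤ Scheme.{0}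
  E : I ⥤ Scheme.{0}
  e : E ⟶ D
  [he : ∀ i, IsOpenImmersion (e.app i)]
  heq : ∀ {i j : I} (f : i ⟶ j) (x : D.obj i), D.map f x ∈ Set.range (e.app j) →
    x ∈ Set.range (e.app i)
  cD : Cone D
  hD : IsLimit cD
  cE : Cone E
  hE : IsLimit cE
  wU : cE.pt ⟶ cD.pt
  w : ∀ i, wU ≫ cD.π.app i = cE.π.app i ≫ e.app i
  hrW : ∀ i (x : cD.pt), cD.π.app i x ∈ Set.range (e.app i) → x ∈ Set.range wU
  V : Scheme.{0}
  [hV : IsAffine V]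
  wV : cE.pt ⟶ V
  [hwV : IsOpenImmersion wV]
  N : Scheme.{0}
  u : cD.pt ⟶ N
  v : V ⟶ N
  [hu : IsOpenImmersion u]
  [hv : IsOpenImmersion v]
  hpb : IsPullback wU wV u v
  hcov : ∀ x : N, x ∈ Set.range u ∨ x ∈ Set.range v
  [hDaff : ∀ {i j : I} (f : i ⟶ j), IsAffineHom (D.map f)]
  [hEaff : ∀ {i j : I} (f : i ⟶ j), IsAffineHom (E.map f)]
  [hDc : ∀ i, CompactSpace (D.obj i)]
  [hDq : ∀ i, QuasiSeparatedSpace (D.obj i)]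
  [hEc : ∀ i, CompactSpace (E.obj i)]
  [hEq : ∀ i, QuasiSeparatedSpace (E.obj i)]
  [hDf : ∀ i, LocallyOfFiniteType (specZIsTerminal.from (D.obj i))]
  ι : Type
  [hι : Finite ι]
  f : ι → Γ(V, ⊤)
  F : ∀ i, ι → Γ(E.obj i, ⊤)
  hF : ∀ {i j : I} (g : i ⟶ j) a, (E.map g).appTop (F j a) = F i a
  hfF : ∀ i a, wV.appTop (f a) = (cE.π.app i).appTop (F i a)
  haff : ∀ i a, IsAffineOpen ((E.obj i).basicOpen (F i a))
  hFcov : ∀ i, ⨆ a, (E.obj i).basicOpen (F i a) = ⊤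
  hfV : ∀ a, (V.basicOpen (f a) : Set V) ⊆ Set.range wV

namespace SD
attribute [instance] cat cof he hV hwV hu hv hDaff hEaff hDc hDq hEc hEq hDf hι
variable (d : SD)

lemma compW : CompactSpace d.cE.pt := Scheme.compactSpace_of_isLimit d.E d.cE d.hE

instance (i : d.I) : LocallyOfFiniteType (specZIsTerminal.from (d.E.obj i)) := by
  rw [specZIsTerminal.hom_ext (specZIsTerminal.from (d.E.obj i))
    (d.e.app i ≫ specZIsTerminal.from (d.D.obj i))]
  infer_instance

/-- the restriction ring map -/
abbrev ρ : Γ(d.V, ⊤) →ₐ[ℤ] Γ(d.cE.pt, ⊤) := d.wV.appTop.hom.toIntAlgHom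
/-- the colimit ring map -/
abbrev γ (i : d.I) : Γ(d.E.obj i, ⊤) →ₐ[ℤ] Γ(d.cE.pt, ⊤) := (d.cE.π.app i).appTop.hom.toIntAlgHom
/-- transition ring map on pairs -/
abbrev tr {i j : d.I} (g : i ⟶ j) :
    (Γ(d.V, ⊤) × Γ(d.E.obj j, ⊤)) →ₐ[ℤ] (Γ(d.V, ⊤) × Γ(d.E.obj i, ⊤)) :=
  AlgHom.prodMap (AlgHom.id ℤ _) (d.E.map g).appTop.hom.toIntAlgHom

lemma tr_apply {i j : d.I} (g : i ⟶ j) (z) : d.tr g z = (z.1, (d.E.map g).appTop z.2) := rfl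

lemma γ_tr {i j : d.I} (g : i ⟶ j) (c : Γ(d.E.obj j, ⊤)) :
    d.γ i ((d.E.map g).appTop c) = d.γ j c := by
  change (d.cE.π.app i).appTop ((d.E.map g).appTop c) = (d.cE.π.app j).appTop c
  rw [← CommRingCat.comp_apply, ← Scheme.Hom.comp_appTop, d.cE.w]

lemma tr_id (i : d.I) (z) : d.tr (𝟙 i) z = z := by
  simp [tr_apply]

lemma tr_comp {i j k : d.I} (g : i ⟶ j) (h : j ⟶ k) (z) :
    d.tr (g ≫ h) z = d.tr g (d.tr h z) := by
  simp only [tr_apply, d.E.map_comp, Scheme.Hom.comp_appTop]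
  rfl

/-- index objects -/
structure Idx where
  i : d.I
  A : Subalgebra ℤ (Γ(d.V, ⊤) × Γ(d.E.obj i, ⊤))
  ft : A.FG
  compat : ∀ e ∈ A, d.ρ e.1 = d.γ i e.2
  seed : ∀ a, (d.f a, d.F i a) ∈ A
  surj : ∀ a c, ∃ m : ℕ, ∃ e ∈ A, e.2 = d.F i a ^ m * c

variable {d}
/-- index morphisms -/
@[ext] structure IdxHom (a b : Idx d) where
  g : a.i ⟶ b.i
  le : ∀ e ∈ b.A, d.tr g e ∈ a.A

instance : Category.{0} (Idx d) where
  Hom := IdxHom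
  id a := ⟨𝟙 _, fun e he => by rwa [tr_id]⟩
  comp f h := ⟨f.g ≫ h.g, fun e he => by rw [tr_comp]; exact f.le _ (h.le _ he)⟩
  id_comp f := IdxHom.ext (Category.id_comp _)
  comp_id f := IdxHom.ext (Category.comp_id _)
  assoc f g h := IdxHom.ext (Category.assoc _ _ _)

@[simp] lemma Idx.id_g (a : Idx d) : IdxHom.g (𝟙 a) = 𝟙 a.i := rfl
@[simp] lemma Idx.comp_g {a b c : Idx d} (f : a ⟶ b) (h : b ⟶ c) :
    IdxHom.g (f ≫ h) = f.g ≫ h.g := rfl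

variable (d)
lemma exists_idx (i : d.I) (A : Subalgebra ℤ (Γ(d.V, ⊤) × Γ(d.E.obj i, ⊤))) (hA : A.FG)
    (hc : ∀ e ∈ A, d.ρ e.1 = d.γ i e.2) : ∃ A' : Subalgebra ℤ (Γ(d.V, ⊤) × Γ(d.E.obj i, ⊤)),
      A ≤ A' ∧ ∃ a : Idx d, ∃ h : a.i = i, h ▸ a.A = A' := by
  have := d.compW
  obtain ⟨A₁, h1, h2, h3, h4, h5⟩ := algK d.ρ (d.γ i) d.f (d.F i) (d.hfF i)
    (fun a x hx => rho_h1 d.wV (d.f a) (d.hfV a) x hx)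
    (fun a g => rho_h2 d.wV (d.f a) (d.hfV a) g)
    (fun a => hft_aux _ (d.haff i a))
  refine ⟨A ⊔ A₁, le_sup_left, ⟨i, A ⊔ A₁, hA.sup (A₁.fg_iff_finiteType.mpr h1), ?_, ?_, ?_⟩, rfl, rfl⟩
  · have : A ⊔ A₁ ≤ AlgHom.equalizer ((d.ρ).comp (AlgHom.fst ℤ _ _))
        ((d.γ i).comp (AlgHom.snd ℤ _ _)) := sup_le hc h2
    exact this
  · intro a; exact (le_sup_right : A₁ ≤ _) (h3 a)
  · intro a c
    obtain ⟨m, e, he, h⟩ := h5 a c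
    exact ⟨m, e, (le_sup_right : A₁ ≤ _) he, h⟩

variable {d} in
lemma Idx.map_compat (a : Idx d) {k : d.I} (g : k ⟶ a.i) :
    ∀ e ∈ a.A.map (d.tr g), d.ρ e.1 = d.γ k e.2 := by
  rintro _ ⟨e, he, rfl⟩
  refine (a.compat e he).trans (d.γ_tr g e.2).symm

lemma exists_idx_le (k : d.I) (A : Subalgebra ℤ (Γ(d.V, ⊤) × Γ(d.E.obj k, ⊤))) (hA : A.FG)
    (hc : ∀ e ∈ A, d.ρ e.1 = d.γ k e.2) : ∃ B, ∃ ft compat seed surj, A ≤ B ∧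
      (⟨k, B, ft, compat, seed, surj⟩ : Idx d).i = k := by
  obtain ⟨A', hA', ⟨i, B, p1, p2, p3, p4⟩, h, h'⟩ := d.exists_idx k A hA hc
  dsimp at h; subst h
  subst h'
  exact ⟨_, p1, p2, p3, p4, hA', rfl⟩

instance : IsCofiltered (Idx d) where
  nonempty := by
    obtain ⟨i⟩ : Nonempty d.I := IsCofiltered.nonempty
    obtain ⟨_, p1, p2, p3, p4, -⟩ := d.exists_idx_le i ⊥ Subalgebra.fg_bot (by
      intro e he
      obtain ⟨n, rfl⟩ := Algebra.mem_bot.mp he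
      simp)
    exact ⟨⟨i, _, p1, p2, p3, p4⟩⟩
  cone_objs a b := by
    let k := IsCofiltered.min a.i b.i
    let ga : k ⟶ a.i := IsCofiltered.minToLeft _ _
    let gb : k ⟶ b.i := IsCofiltered.minToRight _ _
    obtain ⟨B, p1, p2, p3, p4, hB, -⟩ := d.exists_idx_le k (a.A.map (d.tr ga) ⊔ b.A.map (d.tr gb))
      ((a.ft.map _).sup (b.ft.map _)) (by
        have : a.A.map (d.tr ga) ⊔ b.A.map (d.tr gb) ≤
          AlgHom.equalizer ((d.ρ).comp (AlgHom.fst ℤ _ _))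
            ((d.γ k).comp (AlgHom.snd ℤ _ _)) := sup_le (a.map_compat ga) (b.map_compat gb)
        exact this)
    exact ⟨⟨k, B, p1, p2, p3, p4⟩,
      ⟨ga, fun e he => hB (le_sup_left (a := a.A.map (d.tr ga)) ⟨e, he, rfl⟩)⟩,
      ⟨gb, fun e he => hB (le_sup_right (b := b.A.map (d.tr gb)) ⟨e, he, rfl⟩)⟩, trivial⟩
  cone_maps a b f g := by
    let k := IsCofiltered.eq f.g g.g
    let h : k ⟶ a.i := IsCofiltered.eqHom f.g g.g
    obtain ⟨B, p1, p2, p3, p4, hB, -⟩ := d.exists_idx_le k (a.A.map (d.tr h))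
      (a.ft.map _) (a.map_compat h)
    exact ⟨⟨k, B, p1, p2, p3, p4⟩, ⟨h, fun e he => hB ⟨e, he, rfl⟩⟩,
      IdxHom.ext (IsCofiltered.eq_condition f.g g.g)⟩

/-- projection to the old index category -/
def pr : Idx d ⥤ d.I where
  obj a := a.i
  map f := f.g

instance : d.pr.Initial := by
  refine Functor.initial_of_exists_of_isCofiltered _ ?_ ?_
  · intro i
    obtain ⟨_, p1, p2, p3, p4, -⟩ := d.exists_idx_le i ⊥ Subalgebra.fg_bot (by
      intro e he
      obtain ⟨n, rfl⟩ := Algebra.mem_bot.mp he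
      simp)
    exact ⟨⟨i, _, p1, p2, p3, p4⟩, ⟨𝟙 _⟩⟩
  · intro i a s s'
    let k := IsCofiltered.eq s s'
    let h : k ⟶ a.i := IsCofiltered.eqHom s s'
    obtain ⟨B, p1, p2, p3, p4, hB, -⟩ := d.exists_idx_le k (a.A.map (d.tr h))
      (a.ft.map _) (a.map_compat h)
    exact ⟨⟨k, B, p1, p2, p3, p4⟩, ⟨h, fun e he => hB ⟨e, he, rfl⟩⟩,
      IsCofiltered.eq_condition s s'⟩
end SD
end Part5

section Part6
open AlgebraicGeometry CategoryTheory Limits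

noncomputable section
namespace SD
variable {d : SD}

/-- the ring of an index -/
abbrev Idx.rg (a : Idx d) : CommRingCat.{0} := CommRingCat.of a.A

/-- transition of rings -/
def rmap {a b : Idx d} (f : a ⟶ b) : b.rg ⟶ a.rg :=
  CommRingCat.ofHom (((d.tr f.g).comp b.A.val).codRestrict a.A (fun e => IdxHom.le f e e.2)).toRingHom

lemma rmap_apply {a b : Idx d} (f : a ⟶ b) (x : b.rg) :
    ((rmap f x : a.rg) : a.A).1 = d.tr f.g (x : b.A).1 := rfl

/-- first projection -/
def Idx.p1 (a : Idx d) : a.rg ⟶ Γ(d.V, ⊤) :=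
  CommRingCat.ofHom ((RingHom.fst _ _).comp a.A.val.toRingHom)

/-- second projection -/
def Idx.p2 (a : Idx d) : a.rg ⟶ Γ(d.E.obj a.i, ⊤) :=
  CommRingCat.ofHom ((RingHom.snd _ _).comp a.A.val.toRingHom)

lemma p1_apply (a : Idx d) (x : a.rg) : a.p1 x = (x : a.A).1.1 := rfl
lemma p2_apply (a : Idx d) (x : a.rg) : a.p2 x = (x : a.A).1.2 := rfl

lemma rmap_p1 {a b : Idx d} (f : a ⟶ b) : rmap f ≫ a.p1 = b.p1 := rfl
lemma rmap_p2 {a b : Idx d} (f : a ⟶ b) :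
    rmap f ≫ a.p2 = b.p2 ≫ (d.E.map f.g).appTop := rfl
lemma p1_p2 (a : Idx d) :
    a.p1 ≫ d.wV.appTop = a.p2 ≫ (d.cE.π.app a.i).appTop := by
  ext x
  exact a.compat x.1 x.2

lemma rmap_id (a : Idx d) : rmap (𝟙 a) = 𝟙 a.rg := by
  refine CommRingCat.hom_ext (RingHom.ext fun x => Subtype.ext ?_)
  exact (d.tr_id a.i (x : a.A).1)
lemma rmap_comp {a b c : Idx d} (f : a ⟶ b) (g : b ⟶ c) : rmap (f ≫ g) = rmap g ≫ rmap f := by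
  refine CommRingCat.hom_ext (RingHom.ext fun x => Subtype.ext ?_)
  exact (d.tr_comp f.g g.g (x : c.A).1)

variable (d) in
/-- functor of affine charts -/
def sp : Idx d ⥤ Scheme.{0} where
  obj a := Spec a.rg
  map f := Spec.map (rmap f)
  map_id a := by rw [rmap_id, Spec.map_id]
  map_comp f g := by rw [rmap_comp, Spec.map_comp]

/-- the seed -/
def Idx.sd (a : Idx d) (x : d.ι) : a.rg := (⟨_, a.seed x⟩ : a.A)
lemma p2_sd (a : Idx d) (x : d.ι) : a.p2 (a.sd x) = d.F a.i x := rfl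
lemma p1_sd (a : Idx d) (x : d.ι) : a.p1 (a.sd x) = d.f x := rfl
lemma rmap_sd {a b : Idx d} (f : a ⟶ b) (x : d.ι) : rmap f (b.sd x) = a.sd x := by
  refine Subtype.ext (Prod.ext rfl ?_)
  exact d.hF f.g x

/-- chart inclusion -/
def Idx.j (a : Idx d) : d.E.obj a.i ⟶ Spec a.rg := (d.E.obj a.i).toSpecΓ ≫ Spec.map a.p2

lemma j_h1 (a : Idx d) (x : d.ι) (z : a.rg) (hz : a.p2 z = 0) :
    ∃ m : ℕ, a.sd x ^ m * z = 0 := by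
  have h0 : d.wV.appTop (a.p1 z) = 0 := by
    have : d.wV.appTop (a.p1 z) = (d.cE.π.app a.i).appTop (a.p2 z) := congr($(p1_p2 a) z)
    rw [this, hz, map_zero]
  obtain ⟨m, hm⟩ := rho_h1 d.wV (d.f x) (d.hfV x) _ h0
  refine ⟨m, Subtype.ext (Prod.ext ?_ ?_)⟩
  · exact hm
  · change d.F a.i x ^ m * a.p2 z = 0
    rw [hz, mul_zero]

lemma j_h2 (a : Idx d) (x : d.ι) (c : Γ(d.E.obj a.i, ⊤)) :
    ∃ (m : ℕ) (z : a.rg), a.p2 z = a.p2 (a.sd x) ^ m * c := by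
  obtain ⟨m, e, he, h⟩ := a.surj x c
  exact ⟨m, ⟨e, he⟩, h⟩

instance (a : Idx d) : IsOpenImmersion a.j :=
  K1_isOpenImmersion a.p2 a.sd (fun x => d.haff a.i x) (d.hFcov a.i) (j_h1 a) (j_h2 a)

lemma j_range (a : Idx d) (y : Spec a.rg) :
    y ∈ Set.range a.j ↔ ∃ x, y ∈ PrimeSpectrum.basicOpen (a.sd x) :=
  K1_range a.p2 a.sd (fun x => d.haff a.i x) (d.hFcov a.i) (j_h1 a) (j_h2 a) y

lemma j_nat {a b : Idx d} (f : a ⟶ b) : d.E.map f.g ≫ b.j = a.j ≫ Spec.map (rmap f) := by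
  rw [Idx.j, Idx.j, Category.assoc, ← Spec.map_comp, rmap_p2, Spec.map_comp,
    Scheme.toSpecΓ_naturality_assoc]

/-- affine chart of the limit -/
def Idx.vs (a : Idx d) : d.V ⟶ Spec a.rg := d.V.toSpecΓ ≫ Spec.map a.p1

lemma vs_nat {a b : Idx d} (f : a ⟶ b) : a.vs ≫ Spec.map (rmap f) = b.vs := by
  rw [Idx.vs, Category.assoc, ← Spec.map_comp, rmap_p1]
  rfl

lemma wV_vs (a : Idx d) : d.wV ≫ a.vs = d.cE.π.app a.i ≫ a.j := by
  have h1 : d.wV ≫ a.vs = d.cE.pt.toSpecΓ ≫ Spec.map (a.p1 ≫ d.wV.appTop) := by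
    rw [Idx.vs, Spec.map_comp, Scheme.toSpecΓ_naturality_assoc]
  have h2 : d.cE.π.app a.i ≫ a.j =
      d.cE.pt.toSpecΓ ≫ Spec.map (a.p2 ≫ (d.cE.π.app a.i).appTop) := by
    rw [Idx.j, Spec.map_comp, Scheme.toSpecΓ_naturality_assoc]; rfl
  rw [h1, h2, p1_p2]

lemma j_range_map {a b : Idx d} (f : a ⟶ b) (y : Spec a.rg)
    (h : Spec.map (rmap f) y ∈ Set.range b.j) : y ∈ Set.range a.j := by
  rw [j_range] at h ⊢
  obtain ⟨x, hx⟩ := h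
  refine ⟨x, ?_⟩
  rw [← rmap_sd f]
  exact hx

lemma vs_range (a : Idx d) (y : d.V) (h : a.vs y ∈ Set.range a.j) : y ∈ Set.range d.wV := by
  rw [j_range] at h
  obtain ⟨x, hx⟩ := h
  apply d.hfV x
  have : y ∈ a.vs ⁻¹ᵁ PrimeSpectrum.basicOpen (a.sd x) := hx
  rw [Idx.vs, K1_preimage] at this
  exact this

/-- the glued scheme -/
abbrev Idx.n (a : Idx d) : Scheme.{0} := pushout (d.e.app a.i) a.j

abbrev Idx.inl (a : Idx d) : d.D.obj a.i ⟶ a.n := pushout.inl (d.e.app a.i) a.j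
abbrev Idx.inr (a : Idx d) : Spec a.rg ⟶ a.n := pushout.inr (d.e.app a.i) a.j

/-- transition of glued schemes -/
def nmap {a b : Idx d} (f : a ⟶ b) : a.n ⟶ b.n :=
  pushout.map _ _ _ _ (d.D.map f.g) (Spec.map (rmap f)) (d.E.map f.g) (d.e.naturality _).symm (j_nat f).symm

lemma inl_nmap {a b : Idx d} (f : a ⟶ b) : a.inl ≫ nmap f = d.D.map f.g ≫ b.inl :=
  pushout.inl_desc _ _ _
lemma inl_nmap_assoc {a b : Idx d} (f : a ⟶ b) {W : Scheme.{0}} (r : _ ⟶ W) :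
    a.inl ≫ nmap f ≫ r = d.D.map f.g ≫ b.inl ≫ r := by
  rw [← Category.assoc, inl_nmap, Category.assoc]
lemma inr_nmap {a b : Idx d} (f : a ⟶ b) : a.inr ≫ nmap f = Spec.map (rmap f) ≫ b.inr :=
  pushout.inr_desc _ _ _
lemma inr_nmap_assoc {a b : Idx d} (f : a ⟶ b) {W : Scheme.{0}} (r : _ ⟶ W) :
    a.inr ≫ nmap f ≫ r = Spec.map (rmap f) ≫ b.inr ≫ r := by
  rw [← Category.assoc, inr_nmap, Category.assoc]

variable (d) in
/-- functor of glued schemes -/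
def nf : Idx d ⥤ Scheme.{0} where
  obj a := a.n
  map f := nmap f
  map_id a := by
    apply pushout.hom_ext
    · refine (inl_nmap _).trans ?_
      rw [Idx.id_g, d.D.map_id, Category.id_comp, Category.comp_id]
    · refine (inr_nmap _).trans ?_
      rw [rmap_id, Spec.map_id, Category.id_comp, Category.comp_id]
  map_comp f g := by
    apply pushout.hom_ext
    · refine (inl_nmap _).trans ?_
      rw [inl_nmap_assoc, inl_nmap, Idx.comp_g, d.D.map_comp, Category.assoc]
    · refine (inr_nmap _).trans ?_
      rw [inr_nmap_assoc, inr_nmap, rmap_comp, Spec.map_comp, Category.assoc]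

lemma inl_range_map {a b : Idx d} (f : a ⟶ b) (z : a.n) (h : nmap f z ∈ Set.range b.inl) :
    z ∈ Set.range a.inl := by
  rcases po_surj _ _ z with ⟨x, rfl⟩ | ⟨y, rfl⟩
  · exact ⟨x, rfl⟩
  · obtain ⟨t, ht⟩ := h
    have h1 : nmap f (a.inr y) = b.inr (Spec.map (rmap f) y) := by
      rw [← Scheme.Hom.comp_apply, inr_nmap]; rfl
    obtain ⟨q, -, hq⟩ := po_eq _ _ _ _ (ht.trans h1)
    obtain ⟨q', rfl⟩ := j_range_map f y ⟨q, hq⟩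
    exact ⟨d.e.app a.i q', by
      rw [← Scheme.Hom.comp_apply, pushout.condition]; rfl⟩

lemma inr_range_map {a b : Idx d} (f : a ⟶ b) (z : a.n) (h : nmap f z ∈ Set.range b.inr) :
    z ∈ Set.range a.inr := by
  rcases po_surj _ _ z with ⟨x, rfl⟩ | ⟨y, rfl⟩
  · obtain ⟨t, ht⟩ := h
    have h1 : nmap f (a.inl x) = b.inl (d.D.map f.g x) := by
      rw [← Scheme.Hom.comp_apply, inl_nmap]; rfl
    obtain ⟨q, hq, -⟩ := po_eq _ _ _ _ (ht.trans h1).symm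
    obtain ⟨q', rfl⟩ := d.heq f.g x ⟨q, hq⟩
    exact ⟨a.j q', by
      rw [← Scheme.Hom.comp_apply, ← pushout.condition]; rfl⟩
  · exact ⟨y, rfl⟩

end SD
end
end Part6

section Part7
open AlgebraicGeometry CategoryTheory Limits

noncomputable section
namespace SD
variable (d : SD)

/-- ring diagram -/
def rf : (Idx d)ᵒᵖ ⥤ CommRingCat.{0} where
  obj a := a.unop.rg
  map f := rmap f.unop
  map_id a := rmap_id _
  map_comp f g := rmap_comp _ _

/-- ring cocone -/
def rco : Cocone d.rf where
  pt := Γ(d.V, ⊤)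
  ι := { app := fun a => a.unop.p1
         naturality := fun a b f => (rmap_p1 f.unop).trans (Category.comp_id _).symm }

lemma rco_surj (r : Γ(d.V, ⊤)) : ∃ (a : Idx d) (x : a.rg), r = a.p1 x := by
  obtain ⟨i, t, ht⟩ := exists_appTop_π_eq_of_isLimit d.E d.cE d.hE (d.ρ r)
  obtain ⟨B, p1, p2, p3, p4, hB, -⟩ := d.exists_idx_le i (Algebra.adjoin ℤ {(r, t)})
    (Subalgebra.fg_def.mpr ⟨_, Set.finite_singleton _, rfl⟩) (by
      have : Algebra.adjoin ℤ {(r, t)} ≤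
          AlgHom.equalizer ((d.ρ).comp (AlgHom.fst ℤ _ _))
            ((d.γ i).comp (AlgHom.snd ℤ _ _)) := by
        rw [Algebra.adjoin_le_iff, Set.singleton_subset_iff]
        exact ht
      exact this)
  exact ⟨⟨i, B, p1, p2, p3, p4⟩, (⟨(r, t), hB (Algebra.subset_adjoin rfl)⟩ : B), rfl⟩

lemma rco_inj (a : Idx d) (x y : a.rg) (h : a.p1 x = a.p1 y) :
    ∃ (b : Idx d) (f : b ⟶ a), rmap f x = rmap f y := by
  have h1 : (d.cE.π.app a.i).appTop (a.p2 (x - y)) = 0 := by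
    have : d.wV.appTop (a.p1 (x - y)) = (d.cE.π.app a.i).appTop (a.p2 (x - y)) :=
      congr($(p1_p2 a) (x - y))
    rw [← this, map_sub, h, sub_self, map_zero]
  obtain ⟨k, g, hk⟩ := exists_appTop_map_eq_zero_of_isLimit d.E d.cE d.hE _ h1
  obtain ⟨B, p1, p2, p3, p4, hB, -⟩ := d.exists_idx_le k (a.A.map (d.tr g))
      (a.ft.map _) (a.map_compat g)
  refine ⟨⟨k, B, p1, p2, p3, p4⟩, ⟨g, fun e he => hB ⟨e, he, rfl⟩⟩, ?_⟩
  refine Subtype.ext (Prod.ext h ?_)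
  rw [map_sub, map_sub, sub_eq_zero] at hk
  exact hk

lemma rco_isColimit : Nonempty (IsColimit d.rco) := by
  have : ReflectsColimit d.rf (forget CommRingCat.{0}) :=
    reflectsColimit_of_reflectsIsomorphisms _ _
  refine ⟨isColimitOfReflects (forget CommRingCat.{0}) ?_⟩
  refine Types.FilteredColimit.isColimitOf' _ _ ?_ ?_
  · intro r
    obtain ⟨a, x, h⟩ := d.rco_surj r
    exact ⟨.op a, x, h⟩
  · intro a x y h
    obtain ⟨b, f, hf⟩ := d.rco_inj a.unop x y h
    exact ⟨.op b, f.op, hf⟩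

/-- affine cone -/
def spc : Cone d.sp where
  pt := d.V
  π := { app := fun a => a.vs
         naturality := fun a b f => (Category.id_comp _).trans (vs_nat f).symm }

lemma to_spec_eq {X : Scheme.{0}} {R : CommRingCat.{0}} (f : X ⟶ Spec R) :
    X.toSpecΓ ≫ Spec.map ((Scheme.ΓSpecIso R).inv ≫ f.appTop) = f := by
  rw [Spec.map_comp, ← Scheme.toSpecΓ_naturality_assoc]
  simp

lemma to_spec_inj {X : Scheme.{0}} {R : CommRingCat.{0}} (f g : R ⟶ Γ(X, ⊤)) (h :
    X.toSpecΓ ≫ Spec.map f = X.toSpecΓ ≫ Spec.map g) : f = g := by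
  have key (f : R ⟶ Γ(X, ⊤)) : (Scheme.ΓSpecIso R).inv ≫ (X.toSpecΓ ≫ Spec.map f).appTop = f := by
    rw [Scheme.Hom.comp_appTop, ← Scheme.ΓSpecIso_inv_naturality_assoc]
    simp
  rw [← key f, ← key g, h]

lemma rco_desc (R : CommRingCat.{0}) (φ : ∀ a : Idx d, a.rg ⟶ R)
    (h : ∀ {a b : Idx d} (f : a ⟶ b), rmap f ≫ φ a = φ b) :
    ∃ ψ : Γ(d.V, ⊤) ⟶ R, ∀ a : Idx d, a.p1 ≫ ψ = φ a := by
  obtain ⟨hc⟩ := d.rco_isColimit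
  let co : Cocone d.rf :=
    { pt := R
      ι := { app := fun a => φ a.unop
             naturality := fun a b f => (h f.unop).trans (Category.comp_id _).symm } }
  exact ⟨hc.desc co, fun a => hc.fac co (.op a)⟩

lemma rco_uniq (R : CommRingCat.{0}) (ψ ψ' : Γ(d.V, ⊤) ⟶ R)
    (h : ∀ a : Idx d, a.p1 ≫ ψ = a.p1 ≫ ψ') : ψ = ψ' := by
  obtain ⟨hc⟩ := d.rco_isColimit
  exact hc.hom_ext fun a => h a.unop

lemma spc_lift (T : Scheme.{0}) (t : ∀ a : Idx d, T ⟶ Spec a.rg)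
    (h : ∀ {a b : Idx d} (f : a ⟶ b), t a ≫ Spec.map (rmap f) = t b) :
    ∃ m : T ⟶ d.V, ∀ a : Idx d, m ≫ a.vs = t a := by
  choose φ hφ using fun a => (⟨_, to_spec_eq (t a)⟩ :
    ∃ φ : a.rg ⟶ Γ(T, ⊤), T.toSpecΓ ≫ Spec.map φ = t a)
  obtain ⟨ψ, hψ⟩ := d.rco_desc _ φ (fun {a b} f => by
    apply to_spec_inj
    rw [hφ, ← h f, ← hφ a, Spec.map_comp, Category.assoc])
  refine ⟨T.toSpecΓ ≫ Spec.map ψ ≫ d.V.isoSpec.inv, fun a => ?_⟩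
  rw [← hφ, ← hψ, Spec.map_comp, Idx.vs]
  have : d.V.isoSpec.inv ≫ d.V.toSpecΓ = 𝟙 _ := by rw [← Scheme.isoSpec_hom]; simp
  simp [reassoc_of% this]

lemma spc_uniq (T : Scheme.{0}) (m n : T ⟶ d.V) (h : ∀ a : Idx d, m ≫ a.vs = n ≫ a.vs) : m = n := by
  rw [← cancel_mono d.V.isoSpec.hom, Scheme.isoSpec_hom, Scheme.toSpecΓ_naturality,
    Scheme.toSpecΓ_naturality]
  congr 2
  apply d.rco_uniq
  intro a
  apply to_spec_inj
  rw [Spec.map_comp, Spec.map_comp, ← Scheme.toSpecΓ_naturality_assoc,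
    ← Scheme.toSpecΓ_naturality_assoc]
  exact h a

lemma spc_isLimit : Nonempty (IsLimit d.spc) := by
  choose l hl using fun s : Cone d.sp => d.spc_lift s.pt (fun a => s.π.app a) (fun f => s.w f)
  exact ⟨⟨l, hl, fun s m hm => d.spc_uniq _ _ _ fun a => (hm a).trans (hl s a).symm⟩⟩
end SD
end
end Part7

section Part8
open AlgebraicGeometry CategoryTheory Limits

noncomputable section
namespace SD
variable (d : SD)

lemma nc_exists (a : Idx d) : ∃ n : d.N ⟶ a.n, d.u ≫ n = d.cD.π.app a.i ≫ a.inl ∧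
    d.v ≫ n = a.vs ≫ a.inr := by
  refine glue2 d.hpb d.hcov _ _ ?_
  rw [← Category.assoc, d.w, Category.assoc, pushout.condition, ← Category.assoc (W := d.cE.pt),
    ← wV_vs, Category.assoc]

/-- glued cone legs -/
def nc (a : Idx d) : d.N ⟶ a.n := (d.nc_exists a).choose
lemma u_nc (a : Idx d) : d.u ≫ d.nc a = d.cD.π.app a.i ≫ a.inl := (d.nc_exists a).choose_spec.1
lemma v_nc (a : Idx d) : d.v ≫ d.nc a = a.vs ≫ a.inr := (d.nc_exists a).choose_spec.2

lemma nc_nat {a b : Idx d} (f : a ⟶ b) : d.nc a ≫ nmap f = d.nc b := by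
  apply cov2_ext d.u d.v d.hcov
  · rw [← Category.assoc, u_nc, u_nc, Category.assoc, inl_nmap, ← d.cD.w f.g, Category.assoc]
  · rw [← Category.assoc, v_nc, v_nc, Category.assoc, inr_nmap, ← vs_nat f, Category.assoc]

/-- glued cone -/
def ncone : Cone d.nf where
  pt := d.N
  π := { app := fun a => d.nc a
         naturality := fun a b f => (Category.id_comp _).trans (d.nc_nat f).symm }

/-- index of charts -/
def Da : Bool → Idx d ⥤ Scheme.{0} := fun b => b.rec (d.pr ⋙ d.D) d.sp
/-- inclusion of first chart -/
def t1 : d.pr ⋙ d.D ⟶ d.nf where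
  app a := a.inl
  naturality a b f := (inl_nmap f).symm
/-- inclusion of second chart -/
def t2 : d.sp ⟶ d.nf where
  app a := a.inr
  naturality a b f := (inr_nmap f).symm
/-- inclusion of charts -/
def tau : ∀ b, d.Da b ⟶ d.nf := fun b => match b with
  | false => d.t1
  | true => d.t2

/-- cones of charts -/
def ca : ∀ b, Cone (d.Da b) := fun b => match b with
  | false => d.cD.whisker d.pr
  | true => d.spc

lemma inl_nc_range (a : Idx d) (z : d.N) (h : d.nc a z ∈ Set.range a.inl) :
    z ∈ Set.range d.u := by
  rcases d.hcov z with ⟨x, rfl⟩ | ⟨y, rfl⟩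
  · exact ⟨x, rfl⟩
  · obtain ⟨t, ht⟩ := h
    have h1 : d.nc a (d.v y) = a.inr (a.vs y) := by
      rw [← Scheme.Hom.comp_apply, v_nc]; rfl
    obtain ⟨q, -, hq⟩ := po_eq _ _ _ _ (ht.trans h1)
    obtain ⟨q', rfl⟩ := vs_range a y ⟨q, hq⟩
    exact ⟨d.wU q', by
      rw [← Scheme.Hom.comp_apply, d.hpb.w]; rfl⟩

lemma inr_nc_range (a : Idx d) (z : d.N) (h : d.nc a z ∈ Set.range a.inr) :
    z ∈ Set.range d.v := by
  rcases d.hcov z with ⟨x, rfl⟩ | ⟨y, rfl⟩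
  · obtain ⟨t, ht⟩ := h
    have h1 : d.nc a (d.u x) = a.inl (d.cD.π.app a.i x) := by
      rw [← Scheme.Hom.comp_apply, u_nc]; rfl
    obtain ⟨q, hq, -⟩ := po_eq _ _ _ _ (ht.trans h1).symm
    obtain ⟨q', rfl⟩ := d.hrW a.i x ⟨q, hq⟩
    exact ⟨d.wV q', by
      rw [← Scheme.Hom.comp_apply, ← d.hpb.w]; rfl⟩
  · exact ⟨y, rfl⟩

lemma ncone_isLimit : Nonempty (IsLimit d.ncone) := by
  obtain ⟨hs⟩ := d.spc_isLimit
  have h1 : IsLimit (d.cD.whisker d.pr) := (Functor.Initial.isLimitWhiskerEquiv d.pr d.cD).symm d.hD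
  have : ∀ b j, IsOpenImmersion ((d.tau b).app j) := by
    intro b j
    cases b
    · change IsOpenImmersion (Idx.inl j); infer_instance
    · change IsOpenImmersion (Idx.inr j); infer_instance
  let m : ∀ b, (d.ca b).pt ⟶ d.ncone.pt := fun b => match b with
    | false => d.u
    | true => d.v
  have : ∀ b, IsOpenImmersion (m b) := by
    intro b
    cases b
    · exact d.hu
    · exact d.hv
  refine lim_nonempty d.ncone d.Da d.tau d.ca m (fun b => ?_) ?_ ?_ ?_ ?_
  · cases b
    · exact h1
    · exact hs
  · intro b a; cases b
    · exact d.u_nc a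
    · exact d.v_nc a
  · intro b a x hx; cases b
    · exact d.inl_nc_range a x hx
    · exact d.inr_nc_range a x hx
  · intro b i j f x hx; cases b
    · exact inl_range_map f x hx
    · exact inr_range_map f x hx
  · intro a x
    rcases po_surj _ _ x with h | h
    · exact ⟨false, h⟩
    · exact ⟨true, h⟩

lemma pb_of_range {X Y U V : Scheme.{0}} (f : X ⟶ Y) (i : U ⟶ X) (j : V ⟶ Y) (g : U ⟶ V)
    [IsOpenImmersion i] [IsOpenImmersion j] (h : i ≫ f = g ≫ j)
    (hr : ∀ x, f x ∈ Set.range j → x ∈ Set.range i) : IsPullback i g f j := by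
  have hI : Set.range (pullback.fst f j) = Set.range i := by
    rw [IsOpenImmersion.range_pullbackFst]
    ext x
    exact ⟨fun hx => hr x hx, by rintro ⟨y, rfl⟩; exact ⟨g y, by rw [← Scheme.Hom.comp_apply, ← h]; rfl⟩⟩
  let e := IsOpenImmersion.isoOfRangeEq i (pullback.fst f j) hI.symm
  have he : e.hom ≫ pullback.fst f j = i := IsOpenImmersion.isoOfRangeEq_hom_fac _ _ _
  refine IsPullback.of_iso_pullback ⟨h⟩ e he ?_
  rw [← cancel_mono j, Category.assoc, ← pullback.condition, reassoc_of% he, h]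

lemma nmap_affine {a b : Idx d} (f : a ⟶ b) : IsAffineHom (nmap f) := by
  have := @HasAffineProperty.instIsZariskiLocalAtTarget.{0} _ _
    instHasAffinePropertyIsAffineHomIsAffine
  refine (IsZariskiLocalAtTarget.iff_of_openCover (P := @IsAffineHom.{0})
    (cov2 b.inl b.inr (fun x => po_surj _ _ x))).mpr ?_
  intro (c : Bool)
  cases c
  · have := pb_of_range (nmap f) a.inl b.inl (d.D.map f.g) (inl_nmap f) (inl_range_map f)
    change IsAffineHom (pullback.snd (nmap f) b.inl)
    rw [← this.isoPullback_inv_snd]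
    infer_instance
  · have := pb_of_range (nmap f) a.inr b.inr (Spec.map (rmap f)) (inr_nmap f) (inr_range_map f)
    change IsAffineHom (pullback.snd (nmap f) b.inr)
    rw [← this.isoPullback_inv_snd]
    infer_instance

lemma n_compact (a : Idx d) : CompactSpace a.n := by
  constructor
  have : (Set.univ : Set a.n) = Set.range a.inl ∪ Set.range a.inr := by
    ext x; simpa using po_surj _ _ x
  rw [this]
  exact (isCompact_range a.inl.continuous).union (isCompact_range a.inr.continuous)

lemma n_lft (a : Idx d) : LocallyOfFiniteType (specZIsTerminal.from a.n) := by
  have := @HasRingHomProperty.instIsZariskiLocalAtSource.{0} @LocallyOfFiniteType _ inferInstance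
  refine (IsZariskiLocalAtSource.iff_of_openCover (P := @LocallyOfFiniteType.{0})
    (cov2 a.inl a.inr (fun x => po_surj _ _ x))).mpr ?_
  intro (c : Bool)
  cases c
  · change LocallyOfFiniteType (a.inl ≫ _)
    rw [specZIsTerminal.hom_ext (a.inl ≫ _) (specZIsTerminal.from (d.D.obj a.i))]
    exact d.hDf a.i
  · have hA : Algebra.FiniteType ℤ a.A := a.A.fg_iff_finiteType.mp a.ft
    change LocallyOfFiniteType (a.inr ≫ _)
    rw [specZIsTerminal.hom_ext (a.inr ≫ _) (Spec.map (CommRingCat.ofHom (algebraMap ℤ a.A)))]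
    refine (HasRingHomProperty.Spec_iff (P := @LocallyOfFiniteType.{0})).mpr ?_
    exact RingHom.finiteType_algebraMap.mpr hA

lemma n_noeth (a : Idx d) : IsNoetherian a.n := by
  have := d.n_lft a
  have := d.n_compact a
  have : IsLocallyNoetherian a.n :=
    LocallyOfFiniteType.isLocallyNoetherian (specZIsTerminal.from a.n)
  exact {}
end SD
end
end Part8

section Part9
open AlgebraicGeometry CategoryTheory Limits

noncomputable section

/-- approximation data -/
structure Approx (B : Scheme.{0}) where
  I : Type
  [cat : Category.{0} I]
  [cof : IsCofiltered I]
  D : I ⥤ Scheme.{0}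
  π : (Functor.const I).obj B ⟶ D
  hc : IsLimit (Cone.mk B π)
  haff : ∀ {i j : I} (f : i ⟶ j), IsAffineHom (D.map f)
  hcomp : ∀ i, CompactSpace (D.obj i)
  hlft : ∀ i, LocallyOfFiniteType (specZIsTerminal.from (D.obj i))
namespace Approx
attribute [instance] cat cof haff hcomp hlft
end Approx

instance approx_noeth {B : Scheme.{0}} (A : Approx B) (i : A.I) : IsNoetherian (A.D.obj i) := by
  have : IsLocallyNoetherian (A.D.obj i) :=
    LocallyOfFiniteType.isLocallyNoetherian (specZIsTerminal.from (A.D.obj i))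
  exact {}

/-- result of the step -/
def SD.approx (d : SD) : Approx d.N where
  I := d.Idx
  D := d.nf
  π := d.ncone.π
  hc := d.ncone_isLimit.some
  haff f := d.nmap_affine f
  hcomp i := d.n_compact i
  hlft i := d.n_lft i

lemma ev_all {I : Type} [Category.{0} I] [IsCofiltered I] {ι : Type} [Finite ι] {i : I}
    (P : ι → ∀ j, (j ⟶ i) → Prop)
    (hs : ∀ a j (f : j ⟶ i) k (g : k ⟶ j), P a j f → P a k (g ≫ f))
    (h : ∀ a, ∃ j f, P a j f) : ∃ j f, ∀ a, P a j f := by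
  classical
  choose j f hP using h
  cases nonempty_fintype ι
  obtain ⟨k, hk⟩ := IsCofiltered.inf_objs_exists (Finset.univ.image (fun a => Over.mk (f a)))
  refine ⟨k.left, k.hom, fun a => ?_⟩
  obtain ⟨g⟩ := @hk (Over.mk (f a)) (by simp)
  rw [← Over.w g]
  exact hs _ _ _ _ _ (hP a)

lemma ev_obj {I : Type} [Category.{0} I] [IsCofiltered I] {ι : Type} [Finite ι]
    (P : ι → I → Prop)
    (hs : ∀ a j k (g : k ⟶ j), P a j → P a k)
    (h : ∀ a, ∃ j, P a j) : ∃ j, ∀ a, P a j := by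
  classical
  choose j hP using h
  cases nonempty_fintype ι
  obtain ⟨k, hk⟩ := IsCofiltered.inf_objs_exists (Finset.univ.image j)
  refine ⟨k, fun a => ?_⟩
  obtain ⟨g⟩ := @hk (j a) (by simp)
  exact hs _ _ _ g (hP a)

lemma ev_affine {I : Type} [Category.{0} I] [IsCofiltered I] (D : I ⥤ Scheme.{0}) (c : Cone D)
    (hc : IsLimit c) [∀ {i j : I} (f : i ⟶ j), IsAffineHom (D.map f)] [∀ i, IsNoetherian (D.obj i)]
    {i : I} (U : (D.obj i).Opens) (hU : IsAffineOpen (c.π.app i ⁻¹ᵁ U)) :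
    ∃ (j : I) (f : j ⟶ i), IsAffineOpen (D.map f ⁻¹ᵁ U) := by
  obtain ⟨k, V, hV, hVU⟩ := exists_isAffineOpen_preimage_eq D c hc _ hU
  let l := IsCofiltered.min i k
  let gi : l ⟶ i := IsCofiltered.minToLeft _ _
  let gk : l ⟶ k := IsCofiltered.minToRight _ _
  obtain ⟨j, f, h⟩ := exists_map_preimage_eq_map_preimage D c hc (i := l)
    (U := D.map gi ⁻¹ᵁ U) (V := D.map gk ⁻¹ᵁ V) (TopologicalSpace.NoetherianSpace.isCompact _)
    (TopologicalSpace.NoetherianSpace.isCompact _) (by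
      rw [← Scheme.Hom.comp_preimage, ← Scheme.Hom.comp_preimage, c.w, c.w, hVU])
  refine ⟨j, f ≫ gi, ?_⟩
  rw [D.map_comp, Scheme.Hom.comp_preimage, h]
  exact (hV.preimage _).preimage _

/-- Data for the gluing step, without equations. -/
structure SD0 where
  I : Type
  [cat : Category.{0} I]
  [cof : IsCofiltered I]
  D : I ⥤ Scheme.{0}
  E : I ⥤ Scheme.{0}
  e : E ⟶ D
  [he : ∀ i, IsOpenImmersion (e.app i)]
  heq : ∀ {i j : I} (f : i ⟶ j) (x : D.obj i), D.map f x ∈ Set.range (e.app j) →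
    x ∈ Set.range (e.app i)
  cD : Cone D
  hD : IsLimit cD
  cE : Cone E
  hE : IsLimit cE
  wU : cE.pt ⟶ cD.pt
  w : ∀ i, wU ≫ cD.π.app i = cE.π.app i ≫ e.app i
  hrW : ∀ i (x : cD.pt), cD.π.app i x ∈ Set.range (e.app i) → x ∈ Set.range wU
  V : Scheme.{0}
  [hV : IsAffine V]
  wV : cE.pt ⟶ V
  [hwV : IsOpenImmersion wV]
  N : Scheme.{0}
  u : cD.pt ⟶ N
  v : V ⟶ N
  [hu : IsOpenImmersion u]
  [hv : IsOpenImmersion v]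
  hpb : IsPullback wU wV u v
  hcov : ∀ x : N, x ∈ Set.range u ∨ x ∈ Set.range v
  [hDaff : ∀ {i j : I} (f : i ⟶ j), IsAffineHom (D.map f)]
  [hEaff : ∀ {i j : I} (f : i ⟶ j), IsAffineHom (E.map f)]
  [hDc : ∀ i, IsNoetherian (D.obj i)]
  [hEc : ∀ i, IsNoetherian (E.obj i)]
  [hDf : ∀ i, LocallyOfFiniteType (specZIsTerminal.from (D.obj i))]

namespace SD0
attribute [instance] cat cof he hV hwV hu hv hDaff hEaff hDc hEc hDf
variable (d : SD0)

lemma step1 {ι : Type} [Finite ι] (f : ι → Γ(d.V, ⊤)) (i : d.I) (F : ι → Γ(d.E.obj i, ⊤))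
    (hfF : ∀ a, d.wV.appTop (f a) = (d.cE.π.app i).appTop (F a))
    (haff : ∀ a, IsAffineOpen ((d.E.obj i).basicOpen (F a)))
    (hFcov : ⨆ a, (d.E.obj i).basicOpen (F a) = ⊤)
    (hfV : ∀ a, (d.V.basicOpen (f a) : Set d.V) ⊆ Set.range d.wV) : Nonempty (Approx d.N) := by
  let s : SD :=
  { I := Over i
    D := Over.forget i ⋙ d.D
    E := Over.forget i ⋙ d.E
    e := Functor.whiskerLeft (Over.forget i) d.e
    he := fun j => d.he j.left
    heq := fun f => d.heq f.left
    cD := d.cD.whisker (Over.forget i)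
    hD := (Functor.Initial.isLimitWhiskerEquiv (Over.forget i) d.cD).symm d.hD
    cE := d.cE.whisker (Over.forget i)
    hE := (Functor.Initial.isLimitWhiskerEquiv (Over.forget i) d.cE).symm d.hE
    wU := d.wU
    w := fun j => d.w j.left
    hrW := fun j => d.hrW j.left
    V := d.V
    wV := d.wV
    hwV := d.hwV
    N := d.N
    u := d.u
    v := d.v
    hu := d.hu
    hv := d.hv
    hpb := d.hpb
    hcov := d.hcov
    hDaff := fun f => d.hDaff f.left
    hEaff := fun f => d.hEaff f.left
    hDc := fun j => (d.hDc j.left).toCompactSpace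
    hDq := fun j => inferInstanceAs (QuasiSeparatedSpace (d.D.obj j.left))
    hEc := fun j => (d.hEc j.left).toCompactSpace
    hEq := fun j => inferInstanceAs (QuasiSeparatedSpace (d.E.obj j.left))
    hDf := fun j => d.hDf j.left
    ι := ι
    f := f
    F := fun j a => (d.E.map j.hom).appTop (F a)
    hF := fun {j k} g a => by
      change (d.E.map g.left).appTop ((d.E.map k.hom).appTop (F a)) = _
      rw [← CommRingCat.comp_apply, ← Scheme.Hom.comp_appTop, ← d.E.map_comp, Over.w]
    hfF := fun j a => by
      rw [hfF]
      change _ = (d.cE.π.app j.left).appTop ((d.E.map j.hom).appTop (F a))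
      rw [← CommRingCat.comp_apply, ← Scheme.Hom.comp_appTop, d.cE.w]
    haff := fun j a => by
      have := (haff a).preimage (d.E.map j.hom)
      rw [Scheme.preimage_basicOpen_top] at this
      exact this
    hFcov := fun j => by
      have : d.E.map j.hom ⁻¹ᵁ (⨆ a, (d.E.obj i).basicOpen (F a)) = ⊤ := by rw [hFcov]; rfl
      rw [Scheme.Hom.preimage_iSup] at this
      simp only [Scheme.preimage_basicOpen_top] at this
      exact this
    hfV := hfV }
  exact ⟨s.approx⟩

lemma step2 {ι : Type} [Finite ι] (f : ι → Γ(d.V, ⊤))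
    (hfcov : ⨆ a, d.cE.pt.basicOpen (d.wV.appTop (f a)) = ⊤)
    (hfV : ∀ a, (d.V.basicOpen (f a) : Set d.V) ⊆ Set.range d.wV) : Nonempty (Approx d.N) := by
  have h1 : ∀ a, IsAffineOpen (d.cE.pt.basicOpen (d.wV.appTop (f a))) := by
    intro a
    have : IsAffineOpen (d.V.basicOpen (f a)) := (isAffineOpen_top d.V).basicOpen _
    rw [← Scheme.preimage_basicOpen_top]
    exact this.preimage_of_isOpenImmersion d.wV (hfV a)
  obtain ⟨i, hi⟩ := ev_obj (fun (a : ι) (i : d.I) => ∃ F : Γ(d.E.obj i, ⊤),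
    d.wV.appTop (f a) = (d.cE.π.app i).appTop F) (by
      rintro a j k g ⟨F, hF⟩
      refine ⟨(d.E.map g).appTop F, ?_⟩
      rw [hF, ← d.cE.w g, Scheme.Hom.comp_appTop, CommRingCat.comp_apply]) (fun a =>
      exists_appTop_π_eq_of_isLimit d.E d.cE d.hE (d.wV.appTop (f a)))
  choose F hF using hi
  obtain ⟨j, g, hj⟩ := ev_all (fun (a : Option ι) (j : d.I) (g : j ⟶ i) =>
      match a with
      | none => d.E.map g ⁻¹ᵁ (⨆ a, (d.E.obj i).basicOpen (F a)) = ⊤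
      | some a => IsAffineOpen (d.E.map g ⁻¹ᵁ ((d.E.obj i).basicOpen (F a)))) (by
      rintro (_ | a) j f k g h
      · dsimp only at h ⊢
        rw [d.E.map_comp, Scheme.Hom.comp_preimage, h]; rfl
      · dsimp only at h ⊢
        rw [d.E.map_comp, Scheme.Hom.comp_preimage]; exact h.preimage _) (by
      rintro (_ | a)
      · apply exists_map_eq_top d.E d.cE d.hE
        rw [Scheme.Hom.preimage_iSup, ← hfcov]
        refine iSup_congr fun a => ?_
        rw [hF]; exact Scheme.preimage_basicOpen_top _ _
      · apply ev_affine d.E d.cE d.hE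
        rw [Scheme.preimage_basicOpen_top]
        exact (hF a) ▸ (h1 a))
  refine d.step1 f j (fun a => (d.E.map g).appTop (F a)) ?_ ?_ ?_ hfV
  · intro a
    rw [hF, ← d.cE.w g, Scheme.Hom.comp_appTop, CommRingCat.comp_apply]
  · intro a
    have := hj (some a)
    dsimp only at this
    rwa [Scheme.preimage_basicOpen_top] at this
  · have := hj none
    dsimp only at this
    rw [Scheme.Hom.preimage_iSup] at this
    simpa only [Scheme.preimage_basicOpen_top] using this
end SD0
end
end Part9

section Part10
open AlgebraicGeometry CategoryTheory Limits

noncomputable section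

lemma approx_step {U V N : Scheme.{0}} [IsNoetherian N] [IsAffine V] (u : U ⟶ N) (v : V ⟶ N)
    [IsOpenImmersion u] [IsOpenImmersion v] (hcov : ∀ x : N, x ∈ Set.range u ∨ x ∈ Set.range v)
    (A : Approx U) : Nonempty (Approx N) := by
  have : IsLocallyNoetherian U := isLocallyNoetherian_of_isOpenImmersion u
  have : IsLocallyNoetherian V := isLocallyNoetherian_of_isOpenImmersion v
  have nsU : TopologicalSpace.NoetherianSpace U :=
    u.isOpenEmbedding.isInducing.noetherianSpace
  have nsV : TopologicalSpace.NoetherianSpace V :=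
    v.isOpenEmbedding.isInducing.noetherianSpace
  obtain ⟨i, O, -, hO⟩ := exists_preimage_eq A.D (Cone.mk U A.π) A.hc (u ⁻¹ᵁ v.opensRange)
    (TopologicalSpace.NoetherianSpace.isCompact _)
  let W : U.Opens := A.π.app i ⁻¹ᵁ O
  have hW : W = u ⁻¹ᵁ v.opensRange := hO
  let wV : W.toScheme ⟶ V := IsOpenImmersion.lift v (W.ι ≫ u) (by
    rintro _ ⟨x, rfl⟩
    have : W.ι x ∈ u ⁻¹ᵁ v.opensRange := hW.le x.2
    exact this)
  have hwV : wV ≫ v = W.ι ≫ u := IsOpenImmersion.lift_fac _ _ _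
  have : IsOpenImmersion wV := by
    have : IsOpenImmersion (wV ≫ v) := by rw [hwV]; infer_instance
    exact IsOpenImmersion.of_comp wV v
  have hpb : IsPullback W.ι wV u v := SD.pb_of_range u W.ι v wV hwV.symm (by
    intro x hx
    have : x ∈ W := by rw [hW]; exact hx
    simpa using this)
  have hopen : ∀ j : Over i, IsNoetherian ((opensDiagram A.D i O).obj j) := by
    intro j
    have h1 : IsOpenImmersion ((opensDiagramι A.D i O).app j) := inferInstance
    have : IsNoetherian ((Over.forget i ⋙ A.D).obj j) := approx_noeth A j.left
    have : IsLocallyNoetherian ((opensDiagram A.D i O).obj j) :=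
      isLocallyNoetherian_of_isOpenImmersion ((opensDiagramι A.D i O).app j)
    have : TopologicalSpace.NoetherianSpace ((opensDiagram A.D i O).obj j) :=
      ((opensDiagramι A.D i O).app j).isOpenEmbedding.isInducing.noetherianSpace
    exact {}
  let d : SD0 :=
  { I := Over i
    D := Over.forget i ⋙ A.D
    E := opensDiagram A.D i O
    e := opensDiagramι A.D i O
    heq := fun {j k} f x hx => by
      change x ∈ Set.range (A.D.map j.hom ⁻¹ᵁ O).ι
      have hx : A.D.map f.left x ∈ Set.range (A.D.map k.hom ⁻¹ᵁ O).ι := hx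
      rw [Scheme.Opens.range_ι] at hx ⊢
      change A.D.map j.hom x ∈ O
      have h2 : A.D.map j.hom = A.D.map f.left ≫ A.D.map k.hom := by
        rw [← A.D.map_comp, Over.w]
      have h3 : (A.D.map f.left ≫ A.D.map k.hom) x ∈ O := hx
      exact h2 ▸ h3
    cD := (Cone.mk U A.π).whisker (Over.forget i)
    hD := (Functor.Initial.isLimitWhiskerEquiv (Over.forget i) _).symm A.hc
    cE := opensCone A.D (Cone.mk U A.π) i O
    hE := isLimitOpensCone A.D (Cone.mk U A.π) A.hc i O
    wU := W.ι
    w := fun j => (Scheme.Hom.resLE_comp_ι _ _).symm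
    hrW := fun j x hx => by
      have hx : A.π.app j.left x ∈ Set.range (A.D.map j.hom ⁻¹ᵁ O).ι := hx
      change x ∈ Set.range W.ι
      rw [Scheme.Opens.range_ι] at hx ⊢
      have hx : A.D.map j.hom (A.π.app j.left x) ∈ O := hx
      have h2 : A.π.app j.left ≫ A.D.map j.hom = A.π.app i := (Cone.mk U A.π).w j.hom
      have h3 : (A.π.app j.left ≫ A.D.map j.hom) x ∈ O := hx
      rw [h2] at h3
      exact h3
    V := V
    wV := wV
    hwV := this
    N := N
    u := u
    v := v
    hu := inferInstance
    hv := inferInstance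
    hpb := hpb
    hcov := hcov
    hDaff := fun f => A.haff f.left
    hEaff := inferInstance
    hDc := fun j => approx_noeth A j.left
    hEc := hopen
    hDf := fun j => A.hlft j.left }
  have hcp : IsCompact (wV.opensRange : Set V) ∧ IsOpen (wV.opensRange : Set V) :=
    ⟨TopologicalSpace.NoetherianSpace.isCompact _, wV.opensRange.2⟩
  rw [isCompact_and_isOpen_iff_finite_and_eq_biUnion_basicOpen] at hcp
  obtain ⟨s, hs, h⟩ := hcp
  have : Finite s := hs
  refine d.step2 (ι := s) (fun a => a.1) ?_ ?_
  · change ⨆ a : s, W.toScheme.basicOpen (wV.appTop a.1) = ⊤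
    rw [eq_top_iff]
    intro x _
    have hx : wV x ∈ (wV.opensRange : Set V) := ⟨x, rfl⟩
    rw [h] at hx
    simp only [Set.mem_iUnion] at hx
    obtain ⟨a, ha, hx⟩ := hx
    rw [TopologicalSpace.Opens.mem_iSup]
    refine ⟨⟨a, ha⟩, ?_⟩
    rw [← Scheme.preimage_basicOpen_top]
    exact hx
  · intro a x hx
    change x ∈ (wV.opensRange : Set V)
    rw [h]
    simp only [Set.mem_iUnion]
    exact ⟨a.1, a.2, hx⟩

lemma approx_iso {U V : Scheme.{0}} (e : U ≅ V) (A : Approx U) : Nonempty (Approx V) := 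
  ⟨{ I := A.I
     D := A.D
     π := (Functor.const A.I).map e.inv ≫ A.π
     hc := IsLimit.ofIsoLimit A.hc (Cone.ext e (fun j => by simp))
     haff := A.haff
     hcomp := A.hcomp
     hlft := A.hlft }⟩

lemma approx_empty (U : Scheme.{0}) [IsEmpty U] : Nonempty (Approx U) :=
  ⟨{ I := PUnit
     D := (Functor.const _).obj U
     π := 𝟙 _
     hc := 
      { lift := fun s => s.π.app ⟨⟩
        fac := fun s j => by
          cases j
          exact Category.comp_id _
        uniq := fun s m h => by
          have := h ⟨⟩
          exact (Category.comp_id _).symm.trans this }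
     haff := fun f => by
      change IsAffineHom (𝟙 U)
      infer_instance
     hcomp := fun i => by
      change CompactSpace U
      infer_instance
     hlft := fun i => by
      change LocallyOfFiniteType (specZIsTerminal.from U)
      refine ⟨fun {V} hV {W} hW e => ?_⟩
      have h : W = ⊥ := by
        ext x
        exact (IsEmpty.false x).elim
      subst h
      have : Subsingleton Γ(U, ⊥) := inferInstance
      algebraize [(Scheme.Hom.appLE (specZIsTerminal.from U) V ⊥ e).hom]
      exact ⟨⟨∅, by rw [eq_top_iff]; intro x _; rw [Subsingleton.elim x 0]; exact zero_mem _⟩⟩ }⟩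

theorem exists_approx (B : Scheme.{0}) [IsNoetherian B] : Nonempty (Approx B) := by
  have wf : WellFounded ((· > ·) : B.Opens → B.Opens → Prop) :=
    (inferInstance : TopologicalSpace.NoetherianSpace B).wf
  obtain ⟨U, hU, hmax⟩ := wf.has_min {U : B.Opens | Nonempty (Approx U.toScheme)} ⟨⊥, by
    have : IsEmpty (⊥ : B.Opens).toScheme := ⟨fun x => x.2⟩
    exact approx_empty _⟩
  obtain ⟨A⟩ := hU
  have hT : U = ⊤ := by
    by_contra hne
    obtain ⟨x, hx⟩ : ∃ x, x ∉ U := by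
      by_contra! h
      exact hne (eq_top_iff.mpr fun x _ => h x)
    obtain ⟨V, hV, hxV, -⟩ := exists_isAffineOpen_mem_and_subset (U := (⊤ : B.Opens)) (x := x) trivial
    have : IsAffine V.toScheme := hV
    have : IsLocallyNoetherian (U ⊔ V).toScheme :=
      isLocallyNoetherian_of_isOpenImmersion (U ⊔ V).ι
    have : TopologicalSpace.NoetherianSpace (U ⊔ V).toScheme :=
      (U ⊔ V).ι.isOpenEmbedding.isInducing.noetherianSpace
    have : IsNoetherian (U ⊔ V).toScheme := {}
    refine hmax (U ⊔ V) (approx_step (B.homOfLE le_sup_left) (B.homOfLE le_sup_right) ?_ A) ?_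
    · intro y
      rcases y.2 with h | h
      · left
        refine ⟨⟨y.1, h⟩, ?_⟩
        apply (U ⊔ V).ι.isOpenEmbedding.injective
        exact congr($(Scheme.homOfLE_ι B (le_sup_left : U ≤ U ⊔ V)) ⟨y.1, h⟩)
      · right
        refine ⟨⟨y.1, h⟩, ?_⟩
        apply (U ⊔ V).ι.isOpenEmbedding.injective
        exact congr($(Scheme.homOfLE_ι B (le_sup_right : V ≤ U ⊔ V)) ⟨y.1, h⟩)
    · refine lt_of_le_of_ne le_sup_left fun h => hx ?_
      rw [h]
      exact Or.inr hxV
  subst hT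
  exact approx_iso B.topIso A

end
end Part10

section Part11
open AlgebraicGeometry CategoryTheory Limits

noncomputable section

section bc
variable {I : Type} [Category.{0} I] (D : I ⥤ Scheme.{0}) {i : I} {T : Scheme.{0}} (p : T ⟶ D.obj i)

def bcMap {j k : Over i} (f : j ⟶ k) : pullback p (D.map j.hom) ⟶ pullback p (D.map k.hom) :=
  pullback.lift (pullback.fst _ _) (pullback.snd _ _ ≫ D.map f.left) (by
    rw [pullback.condition, Category.assoc, ← D.map_comp, Over.w])

lemma bcMap_fst {j k : Over i} (f : j ⟶ k) : bcMap D p f ≫ pullback.fst _ _ = pullback.fst _ _ :=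
  pullback.lift_fst _ _ _
lemma bcMap_fst_assoc {j k : Over i} (f : j ⟶ k) {W : Scheme.{0}} (r : _ ⟶ W) :
    bcMap D p f ≫ pullback.fst _ _ ≫ r = pullback.fst _ _ ≫ r := by
  rw [← Category.assoc, bcMap_fst]
lemma bcMap_snd {j k : Over i} (f : j ⟶ k) : bcMap D p f ≫ pullback.snd _ _ =
    pullback.snd _ _ ≫ D.map f.left :=
  pullback.lift_snd _ _ _
lemma bcMap_snd_assoc {j k : Over i} (f : j ⟶ k) {W : Scheme.{0}} (r : _ ⟶ W) :
    bcMap D p f ≫ pullback.snd _ _ ≫ r = pullback.snd _ _ ≫ D.map f.left ≫ r := by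
  rw [← Category.assoc, bcMap_snd, Category.assoc]

/-- base change of a diagram -/
def bcF : Over i ⥤ Scheme.{0} where
  obj j := pullback p (D.map j.hom)
  map {j k} f := bcMap D p f
  map_id j := by
    apply pullback.hom_ext
    · rw [bcMap_fst, Category.id_comp]
    · rw [bcMap_snd, Category.id_comp, Over.id_left, D.map_id, Category.comp_id]
  map_comp f g := by
    apply pullback.hom_ext
    · rw [bcMap_fst, Category.assoc, bcMap_fst, bcMap_fst]
    · rw [bcMap_snd, Category.assoc, bcMap_snd, bcMap_snd_assoc, Over.comp_left, D.map_comp]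

def bcFst : bcF D p ⟶ (Functor.const _).obj T where
  app j := pullback.fst p (D.map j.hom)
  naturality j k f := (bcMap_fst D p f).trans (Category.comp_id _).symm

def bcSnd : bcF D p ⟶ Over.forget i ⋙ D where
  app j := pullback.snd p (D.map j.hom)
  naturality j k f := bcMap_snd D p f

lemma bcMap_pb {j k : Over i} (f : j ⟶ k) :
    IsPullback (bcMap D p f) (pullback.snd p (D.map j.hom)) (pullback.snd p (D.map k.hom))
      (D.map f.left) := by
  refine IsPullback.of_right (h₁₂ := pullback.fst p (D.map k.hom)) (v₁₃ := p) (h₂₂ := D.map k.hom) ?_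
    (bcMap_snd D p f) (IsPullback.of_hasPullback p (D.map k.hom))
  rw [bcMap_fst, ← D.map_comp, Over.w]
  exact IsPullback.of_hasPullback p (D.map j.hom)

variable (c : Cone D) (hc : IsLimit c) {S : Scheme.{0}} {g : S ⟶ T} {f : S ⟶ c.pt}

def bcProj (w : g ≫ p = f ≫ c.π.app i) (j : Over i) : S ⟶ pullback p (D.map j.hom) :=
  pullback.lift g (f ≫ c.π.app j.left) (by rw [w, Category.assoc, c.w])

lemma bcProj_fst (w : g ≫ p = f ≫ c.π.app i) (j : Over i) :
    bcProj D p c w j ≫ pullback.fst _ _ = g := pullback.lift_fst _ _ _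
lemma bcProj_fst_assoc (w : g ≫ p = f ≫ c.π.app i) (j : Over i) {W : Scheme.{0}} (r : _ ⟶ W) :
    bcProj D p c w j ≫ pullback.fst _ _ ≫ r = g ≫ r := by
  rw [← Category.assoc, bcProj_fst]
lemma bcProj_snd (w : g ≫ p = f ≫ c.π.app i) (j : Over i) :
    bcProj D p c w j ≫ pullback.snd _ _ = f ≫ c.π.app j.left := pullback.lift_snd _ _ _
lemma bcProj_snd_assoc (w : g ≫ p = f ≫ c.π.app i) (j : Over i) {W : Scheme.{0}} (r : _ ⟶ W) :
    bcProj D p c w j ≫ pullback.snd _ _ ≫ r = f ≫ c.π.app j.left ≫ r := by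
  rw [← Category.assoc, bcProj_snd, Category.assoc]

def bcCone (w : g ≫ p = f ≫ c.π.app i) : Cone (bcF D p) where
  pt := S
  π :=
  { app := fun j => bcProj D p c w j
    naturality := fun j k a => by
      change 𝟙 _ ≫ _ = _ ≫ bcMap D p a
      apply pullback.hom_ext
      · rw [Category.id_comp, Category.assoc, bcMap_fst, bcProj_fst, bcProj_fst]
      · rw [Category.id_comp, Category.assoc, bcMap_snd, bcProj_snd, bcProj_snd_assoc,
          c.w] }

def bcLimit [IsCofiltered I] (hp : IsPullback g f p (c.π.app i)) : IsLimit (bcCone D p c hp.w) := by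
  let hc' : IsLimit (c.whisker (Over.forget i)) :=
    (Functor.Initial.isLimitWhiskerEquiv (Over.forget i) _).symm hc
  have hnat (s : Cone (bcF D p)) (j : Over i) :
      s.π.app j ≫ (bcFst D p).app j = s.π.app (Over.mk (𝟙 i)) ≫ (bcFst D p).app (Over.mk (𝟙 i)) := by
    have := s.w (Over.mkIdTerminal.from j)
    rw [← this, Category.assoc, (bcFst D p).naturality]
    rfl
  let cs (s : Cone (bcF D p)) : Cone (Over.forget i ⋙ D) := (Cone.postcompose (bcSnd D p)).obj s
  have hl (s : Cone (bcF D p)) (j : Over i) : hc'.lift (cs s) ≫ c.π.app j.left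
      = s.π.app j ≫ (bcSnd D p).app j := hc'.fac (cs s) j
  have hw (s : Cone (bcF D p)) : (s.π.app (Over.mk (𝟙 i)) ≫ (bcFst D p).app (Over.mk (𝟙 i))) ≫ p =
      hc'.lift (cs s) ≫ c.π.app i := by
    refine Eq.trans ?_ (hl s (Over.mk (𝟙 i))).symm
    rw [Category.assoc]
    congr 1
    have : (bcFst D p).app (Over.mk (𝟙 i)) ≫ p =
      (bcSnd D p).app (Over.mk (𝟙 i)) ≫ D.map (𝟙 i) := pullback.condition
    exact this.trans ((congrArg (fun z => (bcSnd D p).app (Over.mk (𝟙 i)) ≫ z) (D.map_id i)).trans (Category.comp_id _))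
  exact
  { lift := fun s => hp.lift _ _ (hw s)
    fac := fun s j => by
      apply pullback.hom_ext
      · refine (Category.assoc _ _ _).trans (Eq.trans ?_ (hnat s j).symm)
        refine Eq.trans ?_ (hp.lift_fst _ _ (hw s))
        congr 1
        exact pullback.lift_fst _ _ _
      · refine (Category.assoc _ _ _).trans (Eq.trans ?_ (hl s j))
        refine Eq.trans ?_ (congrArg (fun z => z ≫ c.π.app j.left) (hp.lift_snd _ _ (hw s)))
        refine Eq.trans ?_ (Category.assoc _ _ _).symm
        congr 1
        exact pullback.lift_snd _ _ _
    uniq := fun s m h => by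
      apply hp.hom_ext
      · rw [hp.lift_fst, ← h, Category.assoc]
        congr 1
        exact (pullback.lift_fst _ _ _).symm
      · rw [hp.lift_snd]
        refine hc'.hom_ext fun j => (Category.assoc _ _ _).trans (Eq.trans ?_ (hl s j).symm)
        rw [← h, Category.assoc]
        congr 1
        exact (pullback.lift_snd _ _ _).symm }

lemma bcF_aff [∀ {i j : I} (f : i ⟶ j), IsAffineHom (D.map f)] {j k : Over i} (f : j ⟶ k) :
    IsAffineHom ((bcF D p).map f) :=
  MorphismProperty.of_isPullback (P := @IsAffineHom) (bcMap_pb D p f).flip inferInstance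
end bc

end
end Part11

section Part12
open AlgebraicGeometry CategoryTheory Limits

noncomputable section

section bc
variable {I : Type} [Category.{0} I] [IsCofiltered I] (D : I ⥤ Scheme.{0})
   {i : I} {T : Scheme.{0}} (p : T ⟶ D.obj i)
   [∀ {i j : I} (f : i ⟶ j), IsAffineHom (D.map f)] [∀ i, IsNoetherian (D.obj i)]
   [QuasiCompact p] [QuasiSeparated p]
   (c : Cone D) (hc : IsLimit c) {S : Scheme.{0}} {g : S ⟶ T} {f : S ⟶ c.pt}

lemma bcF_compact (j : Over i) : CompactSpace ((bcF D p).obj j) := by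
  have : CompactSpace ↥(pullback p (D.map j.hom)) :=
    QuasiCompact.compactSpace_of_compactSpace (pullback.snd p (D.map j.hom))
  exact this

lemma bcF_qs (j : Over i) : QuasiSeparatedSpace ((bcF D p).obj j) := by
  have : QuasiSeparatedSpace ↥(pullback p (D.map j.hom)) :=
    quasiSeparatedSpace_of_quasiSeparated (pullback.snd p (D.map j.hom))
  exact this

lemma bc_lift (hc : IsLimit c) (hp : IsPullback g f p (c.π.app i)) {Z W : Scheme.{0}} (q : Z ⟶ W)
    [LocallyOfFinitePresentation q] (t : T ⟶ W) (a : S ⟶ Z) (ha : a ≫ q = g ≫ t) :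
    ∃ (j : Over i) (b : pullback p (D.map j.hom) ⟶ Z), bcProj D p c hp.w j ≫ b = a ∧
      b ≫ q = pullback.fst _ _ ≫ t := by
  have := bcF_compact D p
  have := bcF_qs D p
  have := @bcF_aff _ _ D _ _ p _
  exact Scheme.exists_π_app_comp_eq_of_locallyOfFinitePresentation (bcF D p)
    (bcFst D p ≫ (Functor.const _).map t) q (bcCone D p c hp.w) (bcLimit D p c hc hp) a (by
      ext j : 2
      refine Eq.trans ?_ ha.symm
      exact bcProj_fst_assoc D p c hp.w j t)

lemma bc_eq (hc : IsLimit c) (hp : IsPullback g f p (c.π.app i)) {Z W : Scheme.{0}} (q : Z ⟶ W)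
    [LocallyOfFiniteType q] (t : T ⟶ W) (j : Over i) (a b : pullback p (D.map j.hom) ⟶ Z)
    (ha : a ≫ q = pullback.fst _ _ ≫ t) (hb : b ≫ q = pullback.fst _ _ ≫ t)
    (hab : bcProj D p c hp.w j ≫ a = bcProj D p c hp.w j ≫ b) :
    ∃ (k : Over i) (f : k ⟶ j), bcMap D p f ≫ a = bcMap D p f ≫ b := by
  have := bcF_compact D p
  have := bcF_qs D p
  have := @bcF_aff _ _ D _ _ p _
  exact Scheme.exists_hom_comp_eq_comp_of_locallyOfFiniteType (bcF D p)
    (bcFst D p ≫ (Functor.const _).map t) q (bcCone D p c hp.w) (bcLimit D p c hc hp) (i := j) a b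
    ha.symm hb.symm hab

end bc

/-- base change of approximations -/
def Approx.bc {B S T : Scheme.{0}} (A : Approx B) (i : A.I) (p : T ⟶ A.D.obj i)
    [LocallyOfFiniteType p] [QuasiCompact p] (g : S ⟶ T) (f : S ⟶ B)
    (hp : IsPullback g f p (A.π.app i)) : Approx S where
  I := Over i
  D := bcF A.D p
  π := (bcCone A.D p (Cone.mk B A.π) hp.w).π
  hc := bcLimit A.D p (Cone.mk B A.π) A.hc hp
  haff f := bcF_aff A.D p f
  hcomp j := by
    have : CompactSpace ↥(pullback p (A.D.map j.hom)) :=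
      QuasiCompact.compactSpace_of_compactSpace (pullback.snd p (A.D.map j.hom))
    exact this
  hlft j := by
    have h : specZIsTerminal.from (pullback p (A.D.map j.hom)) =
      pullback.snd p (A.D.map j.hom) ≫ specZIsTerminal.from _ := specZIsTerminal.hom_ext _ _
    have : LocallyOfFiniteType (specZIsTerminal.from (pullback p (A.D.map j.hom))) := by
      rw [h]; infer_instance
    exact this

lemma qs_of_noeth {X Y : Scheme.{0}} (f : X ⟶ Y) [IsNoetherian X] : QuasiSeparated f := inferInstance

section qd
variable {I : Type} [Category.{0} I] [IsCofiltered I] (D : I ⥤ Scheme.{0})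
   [∀ {i j : I} (f : i ⟶ j), IsAffineHom (D.map f)] [∀ i, IsNoetherian (D.obj i)]
   (c : Cone D) {S : Scheme.{0}} (f : S ⟶ c.pt)

def qdMap {i j : I} (a : i ⟶ j) : pullback (f ≫ c.π.app i) (c.π.app i) ⟶
    pullback (f ≫ c.π.app j) (c.π.app j) :=
  pullback.lift (pullback.fst _ _) (pullback.snd _ _) (by
    rw [← c.w a, ← Category.assoc f, pullback.condition_assoc])

lemma qdMap_fst {i j : I} (a : i ⟶ j) : qdMap D c f a ≫ pullback.fst _ _ = pullback.fst _ _ :=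
  pullback.lift_fst _ _ _
lemma qdMap_snd {i j : I} (a : i ⟶ j) : qdMap D c f a ≫ pullback.snd _ _ = pullback.snd _ _ :=
  pullback.lift_snd _ _ _

def qdF : I ⥤ Scheme.{0} where
  obj i := pullback (f ≫ c.π.app i) (c.π.app i)
  map a := qdMap D c f a
  map_id i := by
    apply pullback.hom_ext
    · rw [qdMap_fst, Category.id_comp]
    · rw [qdMap_snd, Category.id_comp]
  map_comp a b := by
    apply pullback.hom_ext
    · rw [Category.assoc, qdMap_fst, qdMap_fst, qdMap_fst]
    · rw [Category.assoc, qdMap_snd, qdMap_snd, qdMap_snd]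

def qdProj (i : I) : S ⟶ pullback (f ≫ c.π.app i) (c.π.app i) :=
  pullback.lift (𝟙 S) f (Category.id_comp _)

lemma qdProj_fst (i : I) : qdProj D c f i ≫ pullback.fst _ _ = 𝟙 S := pullback.lift_fst _ _ _
lemma qdProj_snd (i : I) : qdProj D c f i ≫ pullback.snd _ _ = f := pullback.lift_snd _ _ _

def qdCone : Cone (qdF D c f) where
  pt := S
  π :=
  { app := fun i => qdProj D c f i
    naturality := fun i j a => by
      refine (Category.id_comp _).trans ?_
      change qdProj D c f j = qdProj D c f i ≫ qdMap D c f a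
      apply pullback.hom_ext
      · rw [Category.assoc, qdMap_fst, qdProj_fst, qdProj_fst]
      · rw [Category.assoc, qdMap_snd, qdProj_snd, qdProj_snd] }

def qdFst : qdF D c f ⟶ (Functor.const _).obj S where
  app i := pullback.fst (f ≫ c.π.app i) (c.π.app i)
  naturality i j a := (qdMap_fst D c f a).trans (Category.comp_id _).symm
def qdSnd : qdF D c f ⟶ (Functor.const _).obj c.pt where
  app i := pullback.snd (f ≫ c.π.app i) (c.π.app i)
  naturality i j a := (qdMap_snd D c f a).trans (Category.comp_id _).symm

lemma nat_const {Z : Scheme.{0}} {F : I ⥤ Scheme.{0}} (s : Cone F) (t : F ⟶ (Functor.const _).obj Z) (i j : I) :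
    s.π.app i ≫ t.app i = s.π.app j ≫ t.app j := by
  have key : ∀ {i j : I} (a : i ⟶ j), s.π.app i ≫ t.app i = s.π.app j ≫ t.app j := by
    intro i j a
    rw [← s.w a, Category.assoc, t.naturality]
    exact congrArg (fun z => s.π.app i ≫ z) (Category.comp_id _).symm
  exact (key (IsCofiltered.minToLeft i j)).symm.trans (key (IsCofiltered.minToRight i j))

lemma qdLimit (hc : IsLimit c) : Nonempty (IsLimit (qdCone D c f)) := by
  obtain ⟨i0⟩ := (IsCofiltered.nonempty : Nonempty I)
  refine ⟨{ lift := fun s => s.π.app i0 ≫ (qdFst D c f).app i0, fac := fun s j => ?_,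
            uniq := fun s m h => ?_ }⟩
  · have h1 := nat_const s (qdFst D c f) i0 j
    have h2 : s.π.app j ≫ (qdSnd D c f).app j = (s.π.app j ≫ (qdFst D c f).app j) ≫ f := by
      refine hc.hom_ext fun k => ?_
      rw [nat_const s (qdSnd D c f) j k, nat_const s (qdFst D c f) j k]
      simp only [Category.assoc]
      congr 1
      exact pullback.condition.symm
    refine (congrArg (fun z => z ≫ qdProj D c f j) h1).trans ?_
    apply pullback.hom_ext
    · rw [Category.assoc, qdProj_fst]
      exact Category.comp_id _
    · rw [Category.assoc, qdProj_snd]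
      exact h2.symm
  · refine Eq.trans ?_ (congrArg (fun z => z ≫ (qdFst D c f).app i0) (h i0))
    refine Eq.trans ?_ (Category.assoc _ _ _).symm
    refine (Category.comp_id _).symm.trans ?_
    congr 1
    exact (qdProj_fst D c f i0).symm

lemma qd_fst_aff (hc : IsLimit c) (i : I) : IsAffineHom (pullback.fst (f ≫ c.π.app i) (c.π.app i)) := by
  have h := isAffineHom_π_app D c hc i
  exact MorphismProperty.of_isPullback (P := @IsAffineHom)
    (IsPullback.of_hasPullback (f ≫ c.π.app i) (c.π.app i)).flip h

lemma qdMap_aff (hc : IsLimit c) {i j : I} (a : i ⟶ j) : IsAffineHom (qdMap D c f a) := by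
  have := qd_fst_aff D c f hc
  have h2 : IsAffineHom (qdMap D c f a ≫ pullback.fst _ _) := by
    rw [qdMap_fst]; exact this i
  exact IsAffineHom.of_comp (qdMap D c f a) (pullback.fst _ _)

lemma qd_lift (hc : IsLimit c) [IsNoetherian S] [LocallyOfFinitePresentation f] :
    ∃ (i : I) (r : pullback (f ≫ c.π.app i) (c.π.app i) ⟶ S),
      qdProj D c f i ≫ r = 𝟙 S ∧ r ≫ f = pullback.snd _ _ := by
  have ha := qd_fst_aff D c f hc
  have (i : I) : CompactSpace ((qdF D c f).obj i) := by
    have : CompactSpace ↥(pullback (f ≫ c.π.app i) (c.π.app i)) :=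
      QuasiCompact.compactSpace_of_compactSpace (pullback.fst (f ≫ c.π.app i) (c.π.app i))
    exact this
  have (i : I) : QuasiSeparatedSpace ((qdF D c f).obj i) := by
    have : QuasiSeparatedSpace ↥(pullback (f ≫ c.π.app i) (c.π.app i)) :=
      quasiSeparatedSpace_of_quasiSeparated (pullback.fst (f ≫ c.π.app i) (c.π.app i))
    exact this
  have {i j : I} (a : i ⟶ j) : IsAffineHom ((qdF D c f).map a) := qdMap_aff D c f hc a
  exact Scheme.exists_π_app_comp_eq_of_locallyOfFinitePresentation (qdF D c f)
    (qdSnd D c f) f (qdCone D c f) (qdLimit D c f hc).some (𝟙 S) (by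
      ext j : 2
      exact (qdProj_snd D c f j).trans (Category.id_comp _).symm)
end qd

end
end Part12

section Part13
open AlgebraicGeometry CategoryTheory Limits

noncomputable section

lemma isPullback_of {C : Type*} [Category C] {P X Y Z : C} {g : P ⟶ X} {f : P ⟶ Y} {p : X ⟶ Z} {q : Y ⟶ Z}
    (w : g ≫ p = f ≫ q)
    (h : ∀ {U : C} (u : U ⟶ X) (v : U ⟶ Y), u ≫ p = v ≫ q → ∃ l : U ⟶ P, l ≫ g = u ∧ l ≫ f = v)
    (h2 : ∀ {U : C} (l l' : U ⟶ P), l ≫ g = l' ≫ g → l ≫ f = l' ≫ f → l = l') : IsPullback g f p q := by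
  refine ⟨⟨w⟩, ⟨PullbackCone.IsLimit.mk w (fun s => (h s.fst s.snd s.condition).choose) ?_ ?_ ?_⟩⟩
  · intro s; exact (h s.fst s.snd s.condition).choose_spec.1
  · intro s; exact (h s.fst s.snd s.condition).choose_spec.2
  · intro s m h3 h4
    apply h2
    · rw [h3]; exact (h s.fst s.snd s.condition).choose_spec.1.symm
    · rw [h4]; exact (h s.fst s.snd s.condition).choose_spec.2.symm

/-- equalizer-like descent -/
lemma desc2 {B S M T : Scheme.{0}} (A : Approx B) (f : S ⟶ B) (i : A.I) (m : M ⟶ A.D.obj i)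
    [LocallyOfFiniteType m] [IsNoetherian M] (tM : T ⟶ M) (tB : T ⟶ B)
    (hp : IsPullback tM tB m (A.π.app i)) (σ : S ⟶ T) (b : T ⟶ S) (h1 : σ ≫ b = 𝟙 S)
    (h2 : σ ≫ tB = f) (h3 : b ≫ f = tB) :
    ∃ (k : A.I) (Sk : Scheme.{0}) (p : Sk ⟶ A.D.obj k) (g : S ⟶ Sk),
      LocallyOfFiniteType p ∧ QuasiCompact p ∧ IsPullback g f p (A.π.app k) := by
  obtain ⟨k, e, he, hem⟩ := bc_lift A.D m (Cone.mk B A.π) A.hc hp m m (b ≫ σ ≫ tM) (by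
    simp only [Category.assoc, hp.w]
    rw [reassoc_of% h2, reassoc_of% h3])
  let Mk := pullback m (A.D.map k.hom)
  let pr : T ⟶ Mk := bcProj A.D m (Cone.mk B A.π) hp.w k
  have pr1 : pr ≫ pullback.fst _ _ = tM := bcProj_fst A.D m (Cone.mk B A.π) hp.w k
  have pr2 : pr ≫ pullback.snd _ _ = tB ≫ A.π.app k.left := bcProj_snd A.D m (Cone.mk B A.π) hp.w k
  have hpre : pr ≫ e = b ≫ σ ≫ tM := he
  let d : Mk ⟶ pullback m m := pullback.lift e (pullback.fst _ _) hem
  have hσe : σ ≫ pr ≫ e = σ ≫ tM := by rw [hpre, reassoc_of% h1]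
  have hcond : (σ ≫ pr) ≫ d = (σ ≫ tM) ≫ pullback.diagonal m := by
    apply pullback.hom_ext
    · simp only [Category.assoc, d, pullback.lift_fst, pullback.diagonal_fst, hσe, Category.comp_id]
    · simp only [Category.assoc, d, pullback.lift_snd, pullback.diagonal_snd, pr1, Category.comp_id]
  refine ⟨k.left, pullback d (pullback.diagonal m), pullback.fst _ _ ≫ pullback.snd _ _,
    pullback.lift (σ ≫ pr) (σ ≫ tM) hcond, ?_, ?_, ?_⟩
  · have : LocallyOfFiniteType (pullback.diagonal m) := inferInstance
    have : LocallyOfFiniteType (pullback.fst d (pullback.diagonal m)) := inferInstance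
    infer_instance
  · have : QuasiCompact (pullback.diagonal m) := inferInstance
    have : QuasiCompact (pullback.fst d (pullback.diagonal m)) := inferInstance
    infer_instance
  · have key : ∀ {U : Scheme.{0}} (w : U ⟶ T), w ≫ pr ≫ e = w ≫ tM → w ≫ b ≫ σ = w := by
      intro U w hw
      apply hp.hom_ext
      · rw [← hw, hpre]
        simp only [Category.assoc]
      · simp only [Category.assoc, h2, h3]
    apply isPullback_of
    · rw [pullback.lift_fst_assoc, Category.assoc, pr2, reassoc_of% h2]
    · intro U u v huv
      have hu : u ≫ pullback.fst _ _ ≫ e = u ≫ pullback.fst _ _ ≫ pullback.fst _ _ := by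
        have := congr(u ≫ $(pullback.condition (f := d) (g := pullback.diagonal m)) ≫ pullback.fst _ _)
        have h' := congr(u ≫ $(pullback.condition (f := d) (g := pullback.diagonal m)) ≫ pullback.snd _ _)
        simp only [Category.assoc, d, pullback.lift_fst, pullback.lift_snd, pullback.diagonal_fst,
          pullback.diagonal_snd] at this h'
        rw [this, h']
      let w : U ⟶ T := hp.lift (u ≫ pullback.fst _ _ ≫ pullback.fst _ _) v (by
        have h := (Cone.mk B A.π).w k.hom
        change A.π.app k.left ≫ A.D.map k.hom = A.π.app i at h
        rw [← h]
        simp only [Category.assoc] at huv ⊢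
        rw [pullback.condition (f := m), reassoc_of% huv])
      have w1 : w ≫ tM = u ≫ pullback.fst _ _ ≫ pullback.fst _ _ := hp.lift_fst _ _ _
      have w2 : w ≫ tB = v := hp.lift_snd _ _ _
      have wp : w ≫ pr = u ≫ pullback.fst _ _ := by
        apply pullback.hom_ext
        · simp only [Category.assoc, pr1, w1]
        · simp only [Category.assoc, pr2, reassoc_of% w2]
          simpa using huv.symm
      have hw := key w (by rw [reassoc_of% wp, hu, w1])
      refine ⟨w ≫ b, ?_, ?_⟩
      · rw [← cancel_mono (pullback.fst d (pullback.diagonal m))]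
        simp only [Category.assoc, pullback.lift_fst]
        rw [reassoc_of% hw, wp]
      · simp only [Category.assoc, h3, w2]
    · intro U l l' h4 h5
      have h6 : l ≫ σ = l' ≫ σ := by
        apply hp.hom_ext
        · have := congr($h4 ≫ pullback.snd _ _)
          simpa only [Category.assoc, pullback.lift_snd] using this
        · simpa only [Category.assoc, h2] using h5
      have := congr($h6 ≫ b)
      simpa only [Category.assoc, h1, Category.comp_id] using this

theorem desc {B S : Scheme.{0}} [IsNoetherian B] (A : Approx B) (f : S ⟶ B)
    [LocallyOfFiniteType f] [QuasiCompact f] :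
    ∃ (k : A.I) (Sk : Scheme.{0}) (p : Sk ⟶ A.D.obj k) (g : S ⟶ Sk),
      LocallyOfFiniteType p ∧ QuasiCompact p ∧ IsPullback g f p (A.π.app k) := by
  have : IsLocallyNoetherian S := LocallyOfFiniteType.isLocallyNoetherian f
  have : CompactSpace S := QuasiCompact.compactSpace_of_compactSpace f
  have : IsNoetherian S := {}
  obtain ⟨AS⟩ := exists_approx S
  obtain ⟨i, r, hr1, hr2⟩ := qd_lift A.D (Cone.mk B A.π) f A.hc
  have hr1 : qdProj A.D (Cone.mk B A.π) f i ≫ r = 𝟙 S := hr1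
  let tZ : AS.D ⟶ (Functor.const _).obj (Spec (CommRingCat.of ℤ)) :=
    { app := fun j => specZIsTerminal.from _
      naturality := fun _ _ _ => specZIsTerminal.hom_ext _ _ }
  obtain ⟨j0, q, hq, -⟩ := Scheme.exists_π_app_comp_eq_of_locallyOfFinitePresentation AS.D tZ
    (specZIsTerminal.from (A.D.obj i)) (Cone.mk S AS.π) AS.hc (f ≫ A.π.app i) (by
      ext j : 2
      exact specZIsTerminal.hom_ext _ _)
  have hq : AS.π.app j0 ≫ q = f ≫ A.π.app i := hq
  let S' := pullback (f ≫ A.π.app i) (A.π.app i)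
  have hr2 : r ≫ f = pullback.snd (f ≫ A.π.app i) (A.π.app i) := hr2
  have hπ : IsAffineHom (A.π.app i) := isAffineHom_π_app A.D (Cone.mk B A.π) A.hc i
  let p0 := pullback.fst q (A.π.app i)
  have hp0 : IsAffineHom p0 := MorphismProperty.of_isPullback (P := @IsAffineHom)
    (IsPullback.of_hasPullback q (A.π.app i)).flip hπ
  let g0 : S' ⟶ pullback q (A.π.app i) :=
    pullback.lift (pullback.fst _ _ ≫ AS.π.app j0) (pullback.snd _ _) (by
      rw [Category.assoc, hq, pullback.condition])
  have hg0 : g0 ≫ pullback.snd _ _ = pullback.snd _ _ := pullback.lift_snd _ _ _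
  have hg1 : g0 ≫ p0 = pullback.fst _ _ ≫ AS.π.app j0 := pullback.lift_fst _ _ _
  have hp : IsPullback g0 (pullback.fst _ _) p0 (AS.π.app j0) := by
    refine IsPullback.of_right (h₁₂ := pullback.snd q (A.π.app i)) (v₁₃ := A.π.app i) (h₂₂ := q)
      ?_ hg1 (IsPullback.of_hasPullback q (A.π.app i)).flip
    rw [hg0, hq]
    exact (IsPullback.of_hasPullback _ _).flip
  obtain ⟨j, b, hb1, hb2⟩ := bc_lift AS.D p0 (Cone.mk S AS.π) AS.hc hp f (pullback.snd q (A.π.app i)) r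
    (by rw [hr2, hg0])
  let pr : S' ⟶ pullback p0 (AS.D.map j.hom) := bcProj AS.D p0 (Cone.mk S AS.π) hp.w j
  have pr1 : pr ≫ pullback.fst _ _ = g0 := bcProj_fst AS.D p0 (Cone.mk S AS.π) hp.w j
  have hb1 : pr ≫ b = r := hb1
  have hlft : LocallyOfFiniteType (AS.D.map j.hom ≫ q) := by
    have h : specZIsTerminal.from (AS.D.obj j.left) = (AS.D.map j.hom ≫ q) ≫ specZIsTerminal.from _ :=
      specZIsTerminal.hom_ext _ _
    have : LocallyOfFiniteType ((AS.D.map j.hom ≫ q) ≫ specZIsTerminal.from (A.D.obj i)) := by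
      rw [← h]; infer_instance
    exact locallyOfFiniteType_of_comp _ (specZIsTerminal.from (A.D.obj i))
  let qp : S ⟶ S' := qdProj A.D (Cone.mk B A.π) f i
  have qp2 : qp ≫ pullback.snd _ _ = f := qdProj_snd A.D (Cone.mk B A.π) f i
  refine desc2 A f i (AS.D.map j.hom ≫ q) (pullback.snd _ _)
    (pullback.fst p0 (AS.D.map j.hom) ≫ pullback.snd _ _) ?_ (qp ≫ pr) b ?_ ?_ hb2
  · exact ((IsPullback.of_hasPullback p0 (AS.D.map j.hom)).flip.paste_vert
      (IsPullback.of_hasPullback q (A.π.app i))).flip.flip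
  · rw [Category.assoc, hb1]; exact hr1
  · rw [Category.assoc, reassoc_of% pr1, hg0, qp2]

end
end Part13

section Part14
open AlgebraicGeometry CategoryTheory Limits

noncomputable section

/-- fibers of pulled back families -/
lemma pb_fib {X S B X₀ S₀ B₀ : Scheme.{0}} {x : X ⟶ S} {s : B ⟶ S} {x₀ : X₀ ⟶ S₀} {s₀ : B₀ ⟶ S₀}
    {g : B ⟶ B₀} {gS : S ⟶ S₀} {gX : X ⟶ X₀} (hX : IsPullback gX x x₀ gS)
    (hsg : s ≫ gS = g ≫ s₀) (k : pullback x s ⟶ pullback x₀ s₀)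
    (hk1 : k ≫ pullback.fst _ _ = pullback.fst _ _ ≫ gX)
    (hk2 : k ≫ pullback.snd _ _ = pullback.snd _ _ ≫ g) :
    IsPullback k (pullback.snd _ _) (pullback.snd _ _) g := by
  refine IsPullback.of_right (h₁₂ := pullback.fst x₀ s₀) (v₁₃ := x₀) (h₂₂ := s₀)
    ?_ hk2 (IsPullback.of_hasPullback x₀ s₀)
  rw [hk1, ← hsg]
  exact (IsPullback.of_hasPullback x s).paste_horiz hX

lemma fib_map_cond {X S B X₀ S₀ B₀ : Scheme.{0}} {x : X ⟶ S} {s : B ⟶ S} {x₀ : X₀ ⟶ S₀} {s₀ : B₀ ⟶ S₀}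
    {g : B ⟶ B₀} {gS : S ⟶ S₀} {gX : X ⟶ X₀} (hX : gX ≫ x₀ = x ≫ gS)
    (hsg : s ≫ gS = g ≫ s₀) : (pullback.fst x s ≫ gX) ≫ x₀ = (pullback.snd x s ≫ g) ≫ s₀ := by
  rw [Category.assoc, Category.assoc, hX, ← hsg, pullback.condition_assoc]

theorem assemble
    (B S X Y : Scheme.{0})
    (f : S ⟶ B) (x : X ⟶ S) (y : Y ⟶ S) 
    (s : B ⟶ S) (hs : s ≫ f = 𝟙 B)
    (h : pullback x s ≅ pullback y s)
    (hh : h.hom ≫ pullback.snd y s = pullback.snd x s)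
    (B₀ S₀ X₀ Y₀ : Scheme.{0}) (g : B ⟶ B₀)
      (p₀ : S₀ ⟶ B₀) (x₀ : X₀ ⟶ S₀) (y₀ : Y₀ ⟶ S₀)
   (s₀ : B₀ ⟶ S₀) (hs₀ : s₀ ≫ p₀ = 𝟙 B₀)
        (h₀ : pullback x₀ s₀ ≅ pullback y₀ s₀)
        (hh₀ : h₀.hom ≫ pullback.snd y₀ s₀ = pullback.snd x₀ s₀)
   (gS : S ⟶ S₀) (gX : X ⟶ X₀) (gY : Y ⟶ Y₀) (hS : IsPullback gS f p₀ g)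
   (hX : IsPullback gX x x₀ gS) (hY : IsPullback gY y y₀ gS) (hsg : s ≫ gS = g ≫ s₀)
   (hk : h.hom ≫ pullback.lift (pullback.fst _ _ ≫ gY) (pullback.snd _ _ ≫ g) (fib_map_cond hY.w hsg) =
     pullback.lift (pullback.fst _ _ ≫ gX) (pullback.snd _ _ ≫ g) (fib_map_cond hX.w hsg) ≫ h₀.hom) :
   ∃ 
        (eS : pullback p₀ g ≅ S) (eX : pullback (x₀ ≫ p₀) g ≅ X)
        (eY : pullback (y₀ ≫ p₀) g ≅ Y),
        eS.hom ≫ f = pullback.snd p₀ g ∧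
        eX.hom ≫ x =
          pullback.map (x₀ ≫ p₀) g p₀ g x₀ (𝟙 B) (𝟙 B₀) (by simp) (by simp) ≫ eS.hom ∧
        eY.hom ≫ y =
          pullback.map (y₀ ≫ p₀) g p₀ g y₀ (𝟙 B) (𝟙 B₀) (by simp) (by simp) ≫ eS.hom ∧
        pullback.lift (g ≫ s₀) (𝟙 B)
            (by rw [Category.assoc, hs₀, Category.comp_id, Category.id_comp]) ≫ eS.hom
          = s ∧
        ∃ (uX : pullback (pullback.snd x₀ s₀) g ≅ pullback x s)
          (uY : pullback (pullback.snd y₀ s₀) g ≅ pullback y s),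
          uX.hom ≫ pullback.snd x s = pullback.snd (pullback.snd x₀ s₀) g ∧
          uY.hom ≫ pullback.snd y s = pullback.snd (pullback.snd y₀ s₀) g ∧
          uX.hom ≫ pullback.fst x s =
            pullback.lift
              (pullback.fst (pullback.snd x₀ s₀) g ≫ pullback.fst x₀ s₀)
              (pullback.snd (pullback.snd x₀ s₀) g)
              (by
                rw [Category.assoc, pullback.condition_assoc, hs₀, Category.comp_id,
                  pullback.condition]) ≫
            eX.hom ∧
          uY.hom ≫ pullback.fst y s =
            pullback.lift
              (pullback.fst (pullback.snd y₀ s₀) g ≫ pullback.fst y₀ s₀)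
              (pullback.snd (pullback.snd y₀ s₀) g)
              (by
                rw [Category.assoc, pullback.condition_assoc, hs₀, Category.comp_id,
                  pullback.condition]) ≫
            eY.hom ∧
          uX.hom ≫ h.hom =
            pullback.map (pullback.snd x₀ s₀) g (pullback.snd y₀ s₀) g
              h₀.hom (𝟙 B) (𝟙 B₀)
              (by rw [Category.comp_id]; exact hh₀.symm) (by simp) ≫
            uY.hom := by
  have main : ∀ {X X₀ : Scheme.{0}} (x : X ⟶ S) (x₀ : X₀ ⟶ S₀) (gX : X ⟶ X₀) (hX : IsPullback gX x x₀ gS),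
      ((hX.paste_vert hS).isoPullback.symm.hom ≫ x =
      pullback.map (x₀ ≫ p₀) g p₀ g x₀ (𝟙 B) (𝟙 B₀) (by simp) (by simp) ≫ hS.isoPullback.symm.hom) := by
    intro X X₀ x x₀ gX hX
    apply hS.hom_ext
    · simp only [Category.assoc, Iso.symm_hom, IsPullback.isoPullback_inv_fst, pullback.lift_fst, pullback.map, ← hX.w,
        IsPullback.isoPullback_inv_fst_assoc]
    · simp only [Category.assoc, Iso.symm_hom, IsPullback.isoPullback_inv_snd, pullback.lift_snd, pullback.map,
        Category.comp_id]
  let kX := pullback.lift (pullback.fst _ _ ≫ gX) (pullback.snd _ _ ≫ g) (fib_map_cond hX.w hsg)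
  let kY := pullback.lift (pullback.fst _ _ ≫ gY) (pullback.snd _ _ ≫ g) (fib_map_cond hY.w hsg)
  have fX := pb_fib hX hsg kX (pullback.lift_fst _ _ _) (pullback.lift_snd _ _ _)
  have fY := pb_fib hY hsg kY (pullback.lift_fst _ _ _) (pullback.lift_snd _ _ _)
  have main2 : ∀ {X X₀ : Scheme.{0}} (x : X ⟶ S) (x₀ : X₀ ⟶ S₀) (gX : X ⟶ X₀) (hX : IsPullback gX x x₀ gS)
      (k : pullback x s ⟶ pullback x₀ s₀)
    (hk1 : k ≫ pullback.fst _ _ = pullback.fst _ _ ≫ gX)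
    (fX : IsPullback k (pullback.snd _ _) (pullback.snd _ _) g),
        fX.isoPullback.symm.hom ≫ pullback.fst x s =
            pullback.lift
              (pullback.fst (pullback.snd x₀ s₀) g ≫ pullback.fst x₀ s₀)
              (pullback.snd (pullback.snd x₀ s₀) g)
              (by
                rw [Category.assoc, pullback.condition_assoc, hs₀, Category.comp_id,
                  pullback.condition]) ≫
            (hX.paste_vert hS).isoPullback.symm.hom := by
    intro X X₀ x x₀ gX hX k hk1 fX
    apply (hX.paste_vert hS).hom_ext
    · simp only [Category.assoc, Iso.symm_hom, IsPullback.isoPullback_inv_fst, pullback.lift_fst, ← hk1,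
        IsPullback.isoPullback_inv_fst_assoc]
    · simp only [Category.assoc, Iso.symm_hom, IsPullback.isoPullback_inv_snd, pullback.lift_snd]
      rw [pullback.condition_assoc, hs, Category.comp_id, IsPullback.isoPullback_inv_snd]
  refine ⟨hS.isoPullback.symm, (hX.paste_vert hS).isoPullback.symm, (hY.paste_vert hS).isoPullback.symm,
    hS.isoPullback_inv_snd, main x x₀ gX hX, main y y₀ gY hY, ?_, fX.isoPullback.symm,
    fY.isoPullback.symm, fX.isoPullback_inv_snd, fY.isoPullback_inv_snd,
    main2 x x₀ gX hX kX (pullback.lift_fst _ _ _) fX,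
    main2 y y₀ gY hY kY (pullback.lift_fst _ _ _) fY, ?_⟩
  · apply hS.hom_ext
    · simp only [Category.assoc, Iso.symm_hom, IsPullback.isoPullback_inv_fst, pullback.lift_fst, hsg]
    · simp only [Category.assoc, Iso.symm_hom, IsPullback.isoPullback_inv_snd, pullback.lift_snd, hs]
  · have hk : h.hom ≫ kY = kX ≫ h₀.hom := hk
    apply fY.hom_ext
    · simp only [Category.assoc, Iso.symm_hom, IsPullback.isoPullback_inv_fst, hk,
        IsPullback.isoPullback_inv_fst_assoc, pullback.lift_fst, pullback.map]
    · simp only [Category.assoc, Iso.symm_hom, IsPullback.isoPullback_inv_snd, hh,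
        pullback.lift_snd, pullback.map, Category.comp_id]

section isod
variable {I : Type} [Category.{0} I] (D : I ⥤ Scheme.{0}) {i : I} {P Q : Scheme.{0}}
  (p : P ⟶ D.obj i) (q : Q ⟶ D.obj i)

def toBC {j : Over i} (b : pullback p (D.map j.hom) ⟶ Q) (hb : b ≫ q = pullback.fst _ _ ≫ p) :
    pullback p (D.map j.hom) ⟶ pullback q (D.map j.hom) :=
  pullback.lift b (pullback.snd _ _) (by rw [hb, pullback.condition])

lemma toBC_fst {j : Over i} (b : pullback p (D.map j.hom) ⟶ Q) (hb : b ≫ q = pullback.fst _ _ ≫ p) :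
    toBC D p q b hb ≫ pullback.fst _ _ = b := pullback.lift_fst _ _ _
lemma toBC_fst_assoc {j : Over i} (b : pullback p (D.map j.hom) ⟶ Q) (hb : b ≫ q = pullback.fst _ _ ≫ p) {W : Scheme.{0}} (r : _ ⟶ W) :
    toBC D p q b hb ≫ pullback.fst _ _ ≫ r = b ≫ r := by
  rw [← Category.assoc, toBC_fst]
lemma toBC_snd {j : Over i} (b : pullback p (D.map j.hom) ⟶ Q) (hb : b ≫ q = pullback.fst _ _ ≫ p) :
    toBC D p q b hb ≫ pullback.snd _ _ = pullback.snd _ _ := pullback.lift_snd _ _ _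
lemma toBC_snd_assoc {j : Over i} (b : pullback p (D.map j.hom) ⟶ Q) (hb : b ≫ q = pullback.fst _ _ ≫ p) {W : Scheme.{0}} (r : _ ⟶ W) :
    toBC D p q b hb ≫ pullback.snd _ _ ≫ r = pullback.snd _ _ ≫ r := by
  rw [← Category.assoc, toBC_snd]

lemma bcb {j k : Over i} (f : k ⟶ j) {b : pullback p (D.map j.hom) ⟶ Q}
    (hb : b ≫ q = pullback.fst _ _ ≫ p) : (bcMap D p f ≫ b) ≫ q = pullback.fst _ _ ≫ p := by
  rw [Category.assoc, hb, bcMap_fst_assoc]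

lemma toBC_nat {j k : Over i} (f : k ⟶ j) (b : pullback p (D.map j.hom) ⟶ Q)
    (hb : b ≫ q = pullback.fst _ _ ≫ p) :
    toBC D p q (bcMap D p f ≫ b) (bcb D p q f hb) ≫ bcMap D q f = bcMap D p f ≫ toBC D p q b hb := by
  apply pullback.hom_ext
  · rw [Category.assoc, Category.assoc, bcMap_fst, toBC_fst, toBC_fst]
  · rw [Category.assoc, Category.assoc, bcMap_snd, toBC_snd_assoc, toBC_snd, bcMap_snd]

variable [IsCofiltered I] [∀ {i j : I} (f : i ⟶ j), IsAffineHom (D.map f)] [∀ i, IsNoetherian (D.obj i)]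
   [LocallyOfFiniteType p] [LocallyOfFiniteType q] [QuasiCompact p] [QuasiCompact q]
   [QuasiSeparated p] [QuasiSeparated q]
   (c : Cone D) (hc : IsLimit c) {S T : Scheme.{0}} {gP : S ⟶ P} {f : S ⟶ c.pt} {gQ : T ⟶ Q} {f' : T ⟶ c.pt}

lemma bc_eq' (hc : IsLimit c) (hp : IsPullback gP f p (c.π.app i)) (hq : IsPullback gQ f' q (c.π.app i))
    (h : S ⟶ T) (h' : T ⟶ S) (hh' : h ≫ h' = 𝟙 _)
    (j : Over i) (b : pullback p (D.map j.hom) ⟶ Q) (hb : b ≫ q = pullback.fst _ _ ≫ p)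
    (hb1 : bcProj D p c hp.w j ≫ b = h ≫ gQ) (hf : h ≫ f' = f)
    (b' : pullback q (D.map j.hom) ⟶ P) (hb' : b' ≫ p = pullback.fst _ _ ≫ q)
    (hb1' : bcProj D q c hq.w j ≫ b' = h' ≫ gP) :
    ∃ (k : Over i) (a : k ⟶ j), bcMap D p a ≫ toBC D p q b hb ≫ b' = pullback.fst _ _ := by
  have h1 : bcProj D p c hp.w j ≫ toBC D p q b hb = h ≫ bcProj D q c hq.w j := by
    apply pullback.hom_ext
    · rw [Category.assoc, toBC_fst, hb1, Category.assoc, bcProj_fst]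
    · rw [Category.assoc, toBC_snd, bcProj_snd, Category.assoc, bcProj_snd, reassoc_of% hf]
  obtain ⟨k, a, h⟩ := bc_eq D p c hc hp p p j (toBC D p q b hb ≫ b') (pullback.fst _ _)
    (by rw [Category.assoc, hb', toBC_fst_assoc, hb]) rfl
    (by rw [reassoc_of% h1, hb1', reassoc_of% hh', bcProj_fst])
  exact ⟨k, a, by rw [h, bcMap_fst]⟩

lemma iso_desc (hc : IsLimit c) (hp : IsPullback gP f p (c.π.app i)) (hq : IsPullback gQ f' q (c.π.app i))
    (h : S ≅ T) (hf : h.hom ≫ f' = f) : ∃ (j : Over i)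
    (e : pullback p (D.map j.hom) ≅ pullback q (D.map j.hom)), 
    e.hom ≫ pullback.snd _ _ = pullback.snd _ _ ∧
    bcProj D p c hp.w j ≫ e.hom = h.hom ≫ bcProj D q c hq.w j := by
  have hf' : h.inv ≫ f = f' := by rw [← hf, Iso.inv_hom_id_assoc]
  obtain ⟨j1, b1, h1, h1'⟩ := bc_lift D p c hc hp q p (h.hom ≫ gQ) (by
    rw [Category.assoc, hq.w, reassoc_of% hf, hp.w])
  obtain ⟨j2, b2, h2, h2'⟩ := bc_lift D q c hc hq p q (h.inv ≫ gP) (by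
    rw [Category.assoc, hp.w, reassoc_of% hf', hq.w])
  have hpr : ∀ {j k : Over i} (a : k ⟶ j), bcProj D p c hp.w k ≫ bcMap D p a = bcProj D p c hp.w j :=
    fun a => (bcCone D p c hp.w).w a
  have hqr : ∀ {j k : Over i} (a : k ⟶ j), bcProj D q c hq.w k ≫ bcMap D q a = bcProj D q c hq.w j :=
    fun a => (bcCone D q c hq.w).w a
  let j3 := IsCofiltered.min j1 j2
  let a1 : j3 ⟶ j1 := IsCofiltered.minToLeft _ _
  let a2 : j3 ⟶ j2 := IsCofiltered.minToRight _ _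
  obtain ⟨j4, a4, h4⟩ := bc_eq' D p q c hc hp hq h.hom h.inv h.hom_inv_id j3 (bcMap D p a1 ≫ b1)
    (bcb D p q a1 h1') (by rw [reassoc_of% (hpr a1), h1]) hf (bcMap D q a2 ≫ b2)
    (bcb D q p a2 h2') (by rw [reassoc_of% (hqr a2), h2])
  obtain ⟨j5, a5, h5⟩ := bc_eq' D q p c hc hq hp h.inv h.hom h.inv_hom_id j4
    (bcMap D q a4 ≫ bcMap D q a2 ≫ b2)
    (bcb D q p a4 (bcb D q p a2 h2')) (by rw [reassoc_of% (hqr a4), reassoc_of% (hqr a2), h2]) hf' 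
    (bcMap D p a4 ≫ bcMap D p a1 ≫ b1)
    (bcb D p q a4 (bcb D p q a1 h1')) (by rw [reassoc_of% (hpr a4), reassoc_of% (hpr a1), h1])
  let u1 := bcMap D p a4 ≫ bcMap D p a1 ≫ b1
  let u2 := bcMap D q a4 ≫ bcMap D q a2 ≫ b2
  have hu1 : u1 ≫ q = _ := bcb D p q a4 (bcb D p q a1 h1')
  have hu2 : u2 ≫ p = _ := bcb D q p a4 (bcb D q p a2 h2')
  have k1 : toBC D p q u1 hu1 ≫ u2 = pullback.fst _ _ := by
    have := toBC_nat D p q a4 _ (bcb D p q a1 h1')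
    rw [← h4, ← reassoc_of% this]
  let v1 := bcMap D p a5 ≫ u1
  let v2 := bcMap D q a5 ≫ u2
  have hv1 : v1 ≫ q = _ := bcb D p q a5 hu1
  have hv2 : v2 ≫ p = _ := bcb D q p a5 hu2
  have k3 : toBC D p q v1 hv1 ≫ v2 = pullback.fst _ _ := by
    have := toBC_nat D p q a5 _ hu1
    rw [reassoc_of% this, k1, bcMap_fst]
  have k4 : toBC D q p v2 hv2 ≫ v1 = pullback.fst _ _ := by
    have := toBC_nat D q p a5 _ hu2
    rw [reassoc_of% this]
    exact h5
  refine ⟨j5, ⟨toBC D p q v1 hv1, toBC D q p v2 hv2, ?_, ?_⟩, toBC_snd D p q v1 hv1, ?_⟩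
  · apply pullback.hom_ext
    · rw [Category.assoc, toBC_fst, k3, Category.id_comp]
    · rw [Category.assoc, toBC_snd, toBC_snd, Category.id_comp]
  · apply pullback.hom_ext
    · rw [Category.assoc, toBC_fst, k4, Category.id_comp]
    · rw [Category.assoc, toBC_snd, toBC_snd, Category.id_comp]
  · apply pullback.hom_ext
    · rw [Category.assoc, toBC_fst, Category.assoc, bcProj_fst, reassoc_of% (hpr a5),
        reassoc_of% (hpr a4), reassoc_of% (hpr a1), h1]
    · rw [Category.assoc, toBC_snd, bcProj_snd, Category.assoc, bcProj_snd, reassoc_of% hf]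
end isod
end
end Part14

section Part15
open AlgebraicGeometry CategoryTheory Limits

noncomputable section

lemma refine_pb {B X X₀ B₀ B₁ : Scheme.{0}} {x : X ⟶ B} {x₀ : X₀ ⟶ B₀} {g : B ⟶ B₀} {gX : X ⟶ X₀}
    (hX : IsPullback gX x x₀ g) (g₁ : B ⟶ B₁) (d : B₁ ⟶ B₀) (hd : g₁ ≫ d = g) :
    ∃ (k : X ⟶ pullback x₀ d), k ≫ pullback.fst _ _ = gX ∧
      IsPullback k x (pullback.snd x₀ d) g₁ := by
  have hw : gX ≫ x₀ = (x ≫ g₁) ≫ d := by rw [Category.assoc, hd, hX.w]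
  refine ⟨pullback.lift gX (x ≫ g₁) hw, pullback.lift_fst _ _ _, ?_⟩
  refine IsPullback.of_right (h₁₂ := pullback.fst x₀ d) (v₁₃ := x₀) (h₂₂ := d) ?_
    (pullback.lift_snd _ _ _) (IsPullback.of_hasPullback x₀ d)
  rw [pullback.lift_fst, hd]
  exact hX

lemma desc_two {B X Y : Scheme.{0}} [IsNoetherian B] (A : Approx B) (x : X ⟶ B) (y : Y ⟶ B)
    [LocallyOfFiniteType x] [QuasiCompact x] [LocallyOfFiniteType y] [QuasiCompact y] :
    ∃ (k : A.I) (X₁ Y₁ : Scheme.{0}) (x₁ : X₁ ⟶ A.D.obj k) (y₁ : Y₁ ⟶ A.D.obj k)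
      (gX : X ⟶ X₁) (gY : Y ⟶ Y₁),
      (LocallyOfFiniteType x₁ ∧ QuasiCompact x₁) ∧ (LocallyOfFiniteType y₁ ∧ QuasiCompact y₁) ∧
      IsPullback gX x x₁ (A.π.app k) ∧ IsPullback gY y y₁ (A.π.app k) := by
  obtain ⟨k, X₁, x₁, gX, h1, h2, hX⟩ := desc A x
  obtain ⟨l, Y₁, y₁, gY, h3, h4, hY⟩ := desc A y
  let m := IsCofiltered.min k l
  obtain ⟨u, -, hu⟩ := refine_pb hX (A.π.app m) (A.D.map (IsCofiltered.minToLeft k l))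
    ((Cone.mk B A.π).w (IsCofiltered.minToLeft k l))
  obtain ⟨v, -, hv⟩ := refine_pb hY (A.π.app m) (A.D.map (IsCofiltered.minToRight k l))
    ((Cone.mk B A.π).w (IsCofiltered.minToRight k l))
  exact ⟨m, _, _, _, _, u, v, ⟨inferInstance, inferInstance⟩, ⟨inferInstance, inferInstance⟩, hu, hv⟩

lemma desc_three {B S X Y : Scheme.{0}} [IsNoetherian B] (A : Approx B)
    (f : S ⟶ B) [LocallyOfFiniteType f] [QuasiCompact f] (x : X ⟶ S) (y : Y ⟶ S)
    [LocallyOfFiniteType x] [QuasiCompact x] [LocallyOfFiniteType y] [QuasiCompact y] :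
    ∃ (k : A.I) (S₁ X₁ Y₁ : Scheme.{0}) (p : S₁ ⟶ A.D.obj k) (x₁ : X₁ ⟶ S₁) (y₁ : Y₁ ⟶ S₁)
      (gS : S ⟶ S₁) (gX : X ⟶ X₁) (gY : Y ⟶ Y₁),
      (LocallyOfFiniteType p ∧ QuasiCompact p) ∧
      (LocallyOfFiniteType x₁ ∧ QuasiCompact x₁) ∧ (LocallyOfFiniteType y₁ ∧ QuasiCompact y₁) ∧
      IsPullback gS f p (A.π.app k) ∧
      IsPullback gX x x₁ gS ∧ IsPullback gY y y₁ gS := by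
  obtain ⟨k, S₁, p, gS, h1, h2, hS⟩ := desc A f
  have : IsLocallyNoetherian S := LocallyOfFiniteType.isLocallyNoetherian f
  have : CompactSpace S := QuasiCompact.compactSpace_of_compactSpace f
  have : IsNoetherian S := {}
  obtain ⟨m, X₁, Y₁, x₁, y₁, gX, gY, hx, hy, hX, hY⟩ := desc_two (A.bc k p gS f hS) x y
  let m' : Over k := m
  have hw := hS.w
  refine ⟨m'.left, pullback p (A.D.map m'.hom), X₁, Y₁, pullback.snd _ _, x₁, y₁,
    bcProj A.D p (Cone.mk B A.π) hw m', gX, gY, ⟨inferInstance, inferInstance⟩, hx, hy, ?_, hX, hY⟩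
  refine IsPullback.of_right (h₁₂ := pullback.fst p (A.D.map m'.hom)) (v₁₃ := p)
    (h₂₂ := A.D.map m'.hom) ?_ (bcProj_snd A.D p (Cone.mk B A.π) hw m')
    (IsPullback.of_hasPullback p (A.D.map m'.hom))
  have e1 := bcProj_fst A.D p (Cone.mk B A.π) hw m'
  have e2 : A.π.app m'.left ≫ A.D.map m'.hom = A.π.app k := (Cone.mk B A.π).w m'.hom
  rw [e1, e2]
  exact hS

lemma pb_id {X Y : Scheme.{0}} (u : X ⟶ Y) : IsPullback u (𝟙 X) (𝟙 Y) u :=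
  IsPullback.of_vert_isIso ⟨by simp⟩

lemma desc_sec {B S S₁ : Scheme.{0}} [IsNoetherian B] (A : Approx B) {k : A.I}
    {f : S ⟶ B} {p : S₁ ⟶ A.D.obj k} {gS : S ⟶ S₁} [LocallyOfFiniteType p] 
    (hS : IsPullback gS f p (A.π.app k)) (s : B ⟶ S) (hs : s ≫ f = 𝟙 B) :
    ∃ (j : A.I) (a : j ⟶ k) (t : A.D.obj j ⟶ S₁), t ≫ p = A.D.map a ∧
      A.π.app j ≫ t = s ≫ gS := by
  have hI : IsPullback (A.π.app k) (𝟙 B) (𝟙 (A.D.obj k)) (A.π.app k) := pb_id _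
  have : LocallyOfFinitePresentation p := inferInstance
  obtain ⟨j, b, h1, h2⟩ := bc_lift A.D (𝟙 (A.D.obj k)) (Cone.mk B A.π) A.hc hI p (𝟙 _) (s ≫ gS) (by
    rw [Category.assoc, hS.w, reassoc_of% hs, Category.comp_id])
  refine ⟨j.left, j.hom, pullback.lift (A.D.map j.hom) (𝟙 _) (by simp) ≫ b, ?_, ?_⟩
  · rw [Category.assoc, h2, pullback.lift_fst_assoc, Category.comp_id]
  · rw [← h1, ← Category.assoc]
    congr 1
    apply pullback.hom_ext
    · rw [bcProj_fst, Category.assoc, pullback.lift_fst]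
      exact (Cone.mk B A.π).w j.hom
    · rw [bcProj_snd, Category.assoc, pullback.lift_snd, Category.comp_id]
      exact (Category.id_comp _).symm
end
end Part15

section Part16
open AlgebraicGeometry CategoryTheory Limits

noncomputable section

/-- the fibre of the pulled back family, as a pullback of the original one -/
lemma pbL {X S₁ B₁ B₂ T : Scheme.{0}} (x : X ⟶ S₁) (q : T ⟶ S₁) (u : B₂ ⟶ T) (t : B₁ ⟶ S₁)
    (n : B₂ ⟶ B₁) (hu : u ≫ q = n ≫ t) :
    IsPullback (pullback.fst (pullback.snd x q) u ≫ pullback.fst x q)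
      (pullback.snd (pullback.snd x q) u) x (n ≫ t) := by
  rw [← hu]
  exact (IsPullback.of_hasPullback (pullback.snd x q) u).paste_horiz (IsPullback.of_hasPullback x q)

lemma pbR {X S₁ B₁ B₂ : Scheme.{0}} (x : X ⟶ S₁) (t : B₁ ⟶ S₁) (n : B₂ ⟶ B₁) :
    IsPullback (pullback.fst (pullback.snd x t) n ≫ pullback.fst x t)
      (pullback.snd (pullback.snd x t) n) x (n ≫ t) :=
  (IsPullback.of_hasPullback (pullback.snd x t) n).paste_horiz (IsPullback.of_hasPullback x t)

lemma finish_hk {B S X Y S₁ X₁ Y₁ B₁ B₂ T : Scheme.{0}}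
    {x : X ⟶ S} {y : Y ⟶ S} {s : B ⟶ S} {x₁ : X₁ ⟶ S₁} {y₁ : Y₁ ⟶ S₁}
    {q : T ⟶ S₁} {u : B₂ ⟶ T} {t : B₁ ⟶ S₁} {n : B₂ ⟶ B₁} (hu : u ≫ q = n ≫ t)
    {g₂ : B ⟶ B₂} {gX : X ⟶ X₁} {gY : Y ⟶ Y₁}
    (h : pullback x s ≅ pullback y s) (hh : h.hom ≫ pullback.snd y s = pullback.snd x s)
    (e : pullback (pullback.snd x₁ t) n ≅ pullback (pullback.snd y₁ t) n)
    (he : e.hom ≫ pullback.snd _ _ = pullback.snd _ _)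
    (bX : pullback x s ⟶ pullback (pullback.snd x₁ t) n)
    (bX1 : bX ≫ pullback.fst _ _ ≫ pullback.fst _ _ = pullback.fst _ _ ≫ gX)
    (bX2 : bX ≫ pullback.snd _ _ = pullback.snd _ _ ≫ g₂)
    (bY : pullback y s ⟶ pullback (pullback.snd y₁ t) n)
    (bY1 : bY ≫ pullback.fst _ _ ≫ pullback.fst _ _ = pullback.fst _ _ ≫ gY)
    (bY2 : bY ≫ pullback.snd _ _ = pullback.snd _ _ ≫ g₂)
    (heb : bX ≫ e.hom = h.hom ≫ bY)
    (gX' : X ⟶ pullback x₁ q) (hgX : gX' ≫ pullback.fst _ _ = gX)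
    (gY' : Y ⟶ pullback y₁ q) (hgY : gY' ≫ pullback.fst _ _ = gY)
    (kX : pullback x s ⟶ pullback (pullback.snd x₁ q) u)
    (kX1 : kX ≫ pullback.fst _ _ = pullback.fst _ _ ≫ gX')
    (kX2 : kX ≫ pullback.snd _ _ = pullback.snd _ _ ≫ g₂)
    (kY : pullback y s ⟶ pullback (pullback.snd y₁ q) u)
    (kY1 : kY ≫ pullback.fst _ _ = pullback.fst _ _ ≫ gY')
    (kY2 : kY ≫ pullback.snd _ _ = pullback.snd _ _ ≫ g₂) :
    ∃ h₀ : pullback (pullback.snd x₁ q) u ≅ pullback (pullback.snd y₁ q) u,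
      h₀.hom ≫ pullback.snd _ _ = pullback.snd _ _ ∧ h.hom ≫ kY = kX ≫ h₀.hom := by
  let φX := (pbL x₁ q u t n hu).isoIsPullback _ _ (pbR x₁ t n)
  let φY := (pbL y₁ q u t n hu).isoIsPullback _ _ (pbR y₁ t n)
  have a1 : φX.hom ≫ _ = _ := (pbL x₁ q u t n hu).isoIsPullback_hom_fst _ _ (pbR x₁ t n)
  have a2 : φX.hom ≫ _ = _ := (pbL x₁ q u t n hu).isoIsPullback_hom_snd _ _ (pbR x₁ t n)
  have b1 : φY.inv ≫ _ = _ := (pbL y₁ q u t n hu).isoIsPullback_inv_fst _ _ (pbR y₁ t n)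
  have b2 : φY.inv ≫ _ = _ := (pbL y₁ q u t n hu).isoIsPullback_inv_snd _ _ (pbR y₁ t n)
  have c : kX ≫ φX.hom = bX := by
    apply (pbR x₁ t n).hom_ext
    · rw [Category.assoc, a1, bX1, reassoc_of% kX1, hgX]
    · rw [Category.assoc, a2, bX2, kX2]
  refine ⟨φX ≪≫ e ≪≫ φY.symm, ?_, ?_⟩
  · simp only [Iso.trans_hom, Iso.symm_hom, Category.assoc]
    rw [b2, he, a2]
  · simp only [Iso.trans_hom, Iso.symm_hom, Category.assoc]
    rw [reassoc_of% c, reassoc_of% heb]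
    apply (pbL y₁ q u t n hu).hom_ext
    · simp only [Category.assoc]
      rw [b1, bY1, reassoc_of% kY1, hgY]
    · simp only [Category.assoc]
      rw [b2, kY2, bY2]

theorem exists_model_of_diagram_section_and_fiber_iso_over_finiteType_int'
    (B S X Y : Scheme.{0}) [IsNoetherian B]
    (f : S ⟶ B) [LocallyOfFiniteType f] [QuasiCompact f]
    (x : X ⟶ S) [LocallyOfFiniteType x] [QuasiCompact x]
    (y : Y ⟶ S) [LocallyOfFiniteType y] [QuasiCompact y]
    (s : B ⟶ S) (hs : s ≫ f = 𝟙 B)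
    (h : pullback x s ≅ pullback y s)
    (hh : h.hom ≫ pullback.snd y s = pullback.snd x s) :
    ∃ (B₀ S₀ X₀ Y₀ : Scheme.{0}) (b₀ : B₀ ⟶ Spec (CommRingCat.of ℤ)) (g : B ⟶ B₀)
      (p₀ : S₀ ⟶ B₀) (x₀ : X₀ ⟶ S₀) (y₀ : Y₀ ⟶ S₀),
      (LocallyOfFiniteType b₀ ∧ QuasiCompact b₀) ∧
      (LocallyOfFiniteType p₀ ∧ QuasiCompact p₀) ∧
      (LocallyOfFiniteType x₀ ∧ QuasiCompact x₀) ∧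
      (LocallyOfFiniteType y₀ ∧ QuasiCompact y₀) ∧
      ∃ (s₀ : B₀ ⟶ S₀) (hs₀ : s₀ ≫ p₀ = 𝟙 B₀)
        (h₀ : pullback x₀ s₀ ≅ pullback y₀ s₀)
        (hh₀ : h₀.hom ≫ pullback.snd y₀ s₀ = pullback.snd x₀ s₀)
        (gS : S ⟶ S₀) (gX : X ⟶ X₀) (gY : Y ⟶ Y₀) (hS : IsPullback gS f p₀ g)
        (hX : IsPullback gX x x₀ gS) (hY : IsPullback gY y y₀ gS) (hsg : s ≫ gS = g ≫ s₀),
   (h.hom ≫ pullback.lift (pullback.fst _ _ ≫ gY) (pullback.snd _ _ ≫ g) (fib_map_cond hY.w hsg) =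
     pullback.lift (pullback.fst _ _ ≫ gX) (pullback.snd _ _ ≫ g) (fib_map_cond hX.w hsg) ≫ h₀.hom) := by
  obtain ⟨A⟩ := exists_approx B
  obtain ⟨l, S₁, X₁, Y₁, p, x₁, y₁, gS, gX, gY, ⟨_, _⟩, ⟨_, _⟩, ⟨_, _⟩, hS, hX, hY⟩ := desc_three A f x y
  obtain ⟨j, d, t, htp, ht⟩ := desc_sec A hS s hs
  -- fibers over `D_j`
  have hP := pb_fib hX ht.symm (pullback.lift (pullback.fst _ _ ≫ gX) (pullback.snd _ _ ≫ A.π.app j)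
    (fib_map_cond hX.w ht.symm)) (pullback.lift_fst _ _ _) (pullback.lift_snd _ _ _)
  have hQ := pb_fib hY ht.symm (pullback.lift (pullback.fst _ _ ≫ gY) (pullback.snd _ _ ≫ A.π.app j)
    (fib_map_cond hY.w ht.symm)) (pullback.lift_fst _ _ _) (pullback.lift_snd _ _ _)
  have qs : ∀ {Z : Scheme.{0}} (z : Z ⟶ A.D.obj j) [LocallyOfFiniteType z], QuasiSeparated z := by
    intro Z z _
    have : IsLocallyNoetherian Z := LocallyOfFiniteType.isLocallyNoetherian z
    infer_instance
  have := qs (pullback.snd x₁ t)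
  have := qs (pullback.snd y₁ t)
  obtain ⟨m, e, he, heb⟩ := iso_desc A.D (pullback.snd x₁ t) (pullback.snd y₁ t) (Cone.mk B A.π) A.hc
    hP hQ h hh
  let n := A.D.map m.hom
  let g₂ : B ⟶ A.D.obj m.left := A.π.app m.left
  have hn : g₂ ≫ n = A.π.app j := (Cone.mk B A.π).w m.hom
  have hd : A.π.app j ≫ A.D.map d = A.π.app l := (Cone.mk B A.π).w d
  obtain ⟨gS', hgS, hS'⟩ := refine_pb hS g₂ (n ≫ A.D.map d) (by rw [reassoc_of% hn, hd])
  let q := pullback.fst p (n ≫ A.D.map d)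
  obtain ⟨gX', hgX, hX'⟩ := refine_pb hX gS' q hgS
  obtain ⟨gY', hgY, hY'⟩ := refine_pb hY gS' q hgS
  let u : A.D.obj m.left ⟶ pullback p (n ≫ A.D.map d) := pullback.lift (n ≫ t) (𝟙 _)
    (by rw [Category.assoc, htp, Category.id_comp])
  have hu : u ≫ q = n ≫ t := pullback.lift_fst _ _ _
  have hu2 : u ≫ pullback.snd _ _ = 𝟙 _ := pullback.lift_snd _ _ _
  have hsg : s ≫ gS' = g₂ ≫ u := by
    apply pullback.hom_ext
    · change (s ≫ gS') ≫ q = (g₂ ≫ u) ≫ q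
      rw [Category.assoc, Category.assoc, hu, reassoc_of% hn, ht]
      exact congrArg (s ≫ ·) hgS
    · rw [Category.assoc, Category.assoc, hu2, hS'.w, reassoc_of% hs, Category.comp_id]
  obtain ⟨h₀, hh₀, hk⟩ := finish_hk (q := q) (u := u) (t := t) (n := n) hu (g₂ := g₂) (gX := gX) (gY := gY) h hh e he
    (bcProj A.D (pullback.snd x₁ t) (Cone.mk B A.π) hP.w m)
    (by rw [bcProj_fst_assoc, pullback.lift_fst]) (bcProj_snd _ _ _ _ _)
    (bcProj A.D (pullback.snd y₁ t) (Cone.mk B A.π) hQ.w m)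
    (by rw [bcProj_fst_assoc, pullback.lift_fst]) (bcProj_snd _ _ _ _ _) heb gX' hgX gY' hgY
    (pullback.lift (pullback.fst _ _ ≫ gX') (pullback.snd _ _ ≫ g₂) (fib_map_cond hX'.w hsg))
    (pullback.lift_fst _ _ _) (pullback.lift_snd _ _ _)
    (pullback.lift (pullback.fst _ _ ≫ gY') (pullback.snd _ _ ≫ g₂) (fib_map_cond hY'.w hsg))
    (pullback.lift_fst _ _ _) (pullback.lift_snd _ _ _)
  refine ⟨A.D.obj m.left, _, _, _, specZIsTerminal.from _, g₂, pullback.snd _ _, pullback.snd _ _,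
    pullback.snd _ _, ⟨A.hlft _, inferInstance⟩, ⟨inferInstance, inferInstance⟩, ⟨inferInstance, inferInstance⟩,
    ⟨inferInstance, inferInstance⟩, u, hu2, h₀, hh₀, gS', gX', gY', hS', hX', hY', hsg, hk⟩
end
end Part16

/-- Let `B` be a noetherian scheme, `S` a finite type `B`-scheme, `X`, `Y` finite type
`S`-schemes, `s : B ⟶ S` a section of `S ⟶ B`, and `h : X_s ≅ Y_s` an isomorphism of
`B`-schemes between the fibers.  Then there exist a scheme `B₀` of finite type over
`Spec ℤ`, a morphism `B ⟶ B₀`, a finite type `B₀`-scheme `S₀`, finite type `S₀`-schemes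
`X₀`, `Y₀`, a section `s₀ : B₀ ⟶ S₀` of `S₀ ⟶ B₀` and an isomorphism
`h₀ : (X₀)_{s₀} ≅ (Y₀)_{s₀}` of `B₀`-schemes, such that the base change of the data
`(X₀ ⟶ S₀ ⟵ Y₀, s₀, h₀)` along `B ⟶ B₀` is isomorphic to the original data
`(X ⟶ S ⟵ Y, s, h)`. -/
theorem exists_model_of_diagram_section_and_fiber_iso_over_finiteType_int
    (B S X Y : Scheme) [IsNoetherian B]
    (f : S ⟶ B) [LocallyOfFiniteType f] [QuasiCompact f]
    (x : X ⟶ S) [LocallyOfFiniteType x] [QuasiCompact x]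
    (y : Y ⟶ S) [LocallyOfFiniteType y] [QuasiCompact y]
    (s : B ⟶ S) (hs : s ≫ f = 𝟙 B)
    (h : pullback x s ≅ pullback y s)
    (hh : h.hom ≫ pullback.snd y s = pullback.snd x s) :
    ∃ (B₀ S₀ X₀ Y₀ : Scheme) (b₀ : B₀ ⟶ Spec (CommRingCat.of ℤ)) (g : B ⟶ B₀)
      (p₀ : S₀ ⟶ B₀) (x₀ : X₀ ⟶ S₀) (y₀ : Y₀ ⟶ S₀),
      (LocallyOfFiniteType b₀ ∧ QuasiCompact b₀) ∧
      (LocallyOfFiniteType p₀ ∧ QuasiCompact p₀) ∧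
      (LocallyOfFiniteType x₀ ∧ QuasiCompact x₀) ∧
      (LocallyOfFiniteType y₀ ∧ QuasiCompact y₀) ∧
      ∃ (s₀ : B₀ ⟶ S₀) (hs₀ : s₀ ≫ p₀ = 𝟙 B₀)
        (h₀ : pullback x₀ s₀ ≅ pullback y₀ s₀)
        (hh₀ : h₀.hom ≫ pullback.snd y₀ s₀ = pullback.snd x₀ s₀)
        (eS : pullback p₀ g ≅ S) (eX : pullback (x₀ ≫ p₀) g ≅ X)
        (eY : pullback (y₀ ≫ p₀) g ≅ Y),
        -- the isomorphisms are compatible with the structure morphisms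
        eS.hom ≫ f = pullback.snd p₀ g ∧
        eX.hom ≫ x =
          pullback.map (x₀ ≫ p₀) g p₀ g x₀ (𝟙 B) (𝟙 B₀) (by simp) (by simp) ≫ eS.hom ∧
        eY.hom ≫ y =
          pullback.map (y₀ ≫ p₀) g p₀ g y₀ (𝟙 B) (𝟙 B₀) (by simp) (by simp) ≫ eS.hom ∧
        -- the base change of the section `s₀` is the section `s`
        pullback.lift (g ≫ s₀) (𝟙 B)
            (by rw [Category.assoc, hs₀, Category.comp_id, Category.id_comp]) ≫ eS.hom
          = s ∧
        -- the base change of `h₀` is identified with `h` via the canonical comparison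
        -- isomorphisms `(X₀)_{s₀} ×_{B₀} B ≅ X_s` and `(Y₀)_{s₀} ×_{B₀} B ≅ Y_s`
        ∃ (uX : pullback (pullback.snd x₀ s₀) g ≅ pullback x s)
          (uY : pullback (pullback.snd y₀ s₀) g ≅ pullback y s),
          uX.hom ≫ pullback.snd x s = pullback.snd (pullback.snd x₀ s₀) g ∧
          uY.hom ≫ pullback.snd y s = pullback.snd (pullback.snd y₀ s₀) g ∧
          uX.hom ≫ pullback.fst x s =
            pullback.lift
              (pullback.fst (pullback.snd x₀ s₀) g ≫ pullback.fst x₀ s₀)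
              (pullback.snd (pullback.snd x₀ s₀) g)
              (by
                rw [Category.assoc, pullback.condition_assoc, hs₀, Category.comp_id,
                  pullback.condition]) ≫
            eX.hom ∧
          uY.hom ≫ pullback.fst y s =
            pullback.lift
              (pullback.fst (pullback.snd y₀ s₀) g ≫ pullback.fst y₀ s₀)
              (pullback.snd (pullback.snd y₀ s₀) g)
              (by
                rw [Category.assoc, pullback.condition_assoc, hs₀, Category.comp_id,
                  pullback.condition]) ≫
            eY.hom ∧
          uX.hom ≫ h.hom =
            pullback.map (pullback.snd x₀ s₀) g (pullback.snd y₀ s₀) g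
              h₀.hom (𝟙 B) (𝟙 B₀)
              (by rw [Category.comp_id]; exact hh₀.symm) (by simp) ≫
            uY.hom := by
  obtain ⟨B₀, S₀, X₀, Y₀, b₀, g, p₀, x₀, y₀, hb, hp, hx, hy, s₀, hs₀, h₀, hh₀, gS, gX, gY, hS, hX, hY,
    hsg, hk⟩ :=
    exists_model_of_diagram_section_and_fiber_iso_over_finiteType_int' B S X Y f x y s hs h hh
  exact ⟨B₀, S₀, X₀, Y₀, b₀, g, p₀, x₀, y₀, hb, hp, hx, hy, s₀, hs₀, h₀, hh₀,
    assemble B S X Y f x y s hs h hh B₀ S₀ X₀ Y₀ g p₀ x₀ y₀ s₀ hs₀ h₀ hh₀ gS gX gY hS hX hY hsg hk⟩
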